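/- ∫_0^∞ x^5/(cos x + cosh x)^3 dx = 15Γ^4/(2^8 π) + 5Γ^12/(2^13 π^5) − 5Γ^12/(2^13 π^4) + 3Γ^12/(2^15 π^3) + Γ^20/(2^20 π^9), where Γ = Γ(1/4). -/

import Mathlib

open Real

/-- The term of the double Lambert series `lambert`. -/
noncomputable def lambertTerm (e : ℕ) (σ : ℕ → ℕ → ℝ) (i k j : ℕ) (u β : ℝ) (x : ℕ × ℕ) : ℝ :=
  σ x.1 x.2 * (2 * x.1 + 1 + e : ℝ) ^ i * (2 * x.2 + 1 : ℝ) ^ k *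
    exp (-((2 * x.1 + 1 + e) * (2 * x.2 + 1) * β)) *
    sin ((2 * x.1 + 1 + e) * u + j * (π / 2))

/-- The sum of `σ n^i b^k exp(-n b β) sin(n u + j π / 2)` over `n = 2m + 1 + e` and odd `b`. -/
noncomputable def lambert (e : ℕ) (σ : ℕ → ℕ → ℝ) (i k j : ℕ) (u β : ℝ) : ℝ :=
  ∑' x : ℕ × ℕ, lambertTerm e σ i k j u β x

lemma summable_affine_pow_mul_exp (e i : ℕ) {β : ℝ} (hβ : 0 < β) :
    Summable fun m : ℕ => (2 * m + 1 + e : ℝ) ^ i * exp (-(m * β)) := by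
  have h := (summable_nat_add_iff (1 + e)).mpr (Real.summable_pow_mul_exp_neg_nat_mul i hβ)
  refine Summable.of_nonneg_of_le (fun m => by positivity) (fun m => ?_)
    (h.mul_left (2 ^ i * exp ((1 + e) * β)))
  have h1 : (2 * m + 1 + e : ℝ) ^ i ≤ (2 * (m + (1 + e))) ^ i := by
    apply pow_le_pow_left₀ (by positivity)
    have : (0 : ℝ) ≤ e := by positivity
    linarith
  have h2 : exp (-(m * β)) = exp ((1 + e) * β) * exp (-β * (m + (1 + e))) := by
    rw [← exp_add]; congr 1; ring
  calc _ ≤ (2 * (m + (1 + e) : ℝ)) ^ i * exp (-(m * β)) := by gcongr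
    _ = _ := by rw [h2, mul_pow]; push_cast; ring

/-- The majorant of the terms of `lambert`. -/
noncomputable def lambertBound (e i k : ℕ) (β : ℝ) (x : ℕ × ℕ) : ℝ :=
  (2 * x.1 + 1 + e : ℝ) ^ i * (2 * x.2 + 1 : ℝ) ^ k *
    exp (-((2 * x.1 + 1 + e) * (2 * x.2 + 1) * β))

lemma summable_lambertBound (e i k : ℕ) {β : ℝ} (hβ : 0 < β) :
    Summable (lambertBound e i k β) := by
  have h1 := summable_affine_pow_mul_exp e i hβ
  have h2 := summable_affine_pow_mul_exp 0 k hβ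
  refine Summable.of_nonneg_of_le (fun x => by unfold lambertBound; positivity) (fun x => ?_)
    (h1.mul_of_nonneg h2 (fun _ => by positivity) (fun _ => by positivity))
  obtain ⟨m, l⟩ := x
  have h3 : exp (-((2 * m + 1 + e) * (2 * l + 1) * β)) ≤ exp (-(m * β)) * exp (-(l * β)) := by
    rw [← exp_add]
    apply exp_le_exp.mpr
    have : (m + l : ℝ) * β ≤ (2 * m + 1 + e) * (2 * l + 1) * β := by
      apply mul_le_mul_of_nonneg_right _ hβ.le
      have : (0 : ℝ) ≤ m := by positivity
      have : (0 : ℝ) ≤ l := by positivity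
      have : (0 : ℝ) ≤ e := by positivity
      nlinarith [mul_nonneg ‹(0 : ℝ) ≤ m› ‹(0 : ℝ) ≤ l›, mul_nonneg ‹(0 : ℝ) ≤ e› ‹(0 : ℝ) ≤ l›]
    linarith
  unfold lambertBound
  calc _ ≤ (2 * m + 1 + e : ℝ) ^ i * (2 * l + 1 : ℝ) ^ k *
        (exp (-(m * β)) * exp (-(l * β))) := by gcongr
    _ = _ := by push_cast; ring

lemma lambertBound_anti {e i k : ℕ} {β₁ β₂ : ℝ} (h : β₁ ≤ β₂) (x : ℕ × ℕ) :
    lambertBound e i k β₂ x ≤ lambertBound e i k β₁ x := by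
  unfold lambertBound
  gcongr

lemma norm_lambertTerm_le {e : ℕ} {σ : ℕ → ℕ → ℝ} (hσ : ∀ m l, |σ m l| ≤ 1) (i k j : ℕ)
    (u β : ℝ) (x : ℕ × ℕ) : ‖lambertTerm e σ i k j u β x‖ ≤ lambertBound e i k β x := by
  unfold lambertTerm
  rw [norm_mul, norm_mul, norm_mul, norm_mul, norm_eq_abs, norm_eq_abs (sin _)]
  have h1 : ‖(2 * x.1 + 1 + e : ℝ) ^ i‖ = (2 * x.1 + 1 + e : ℝ) ^ i :=
    norm_of_nonneg (by positivity)
  have h2 : ‖(2 * x.2 + 1 : ℝ) ^ k‖ = (2 * x.2 + 1 : ℝ) ^ k := norm_of_nonneg (by positivity)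
  have h3 := norm_of_nonneg (exp_pos (-((2 * x.1 + 1 + e) * (2 * x.2 + 1) * β))).le
  rw [h1, h2, h3]
  calc _ ≤ 1 * (2 * x.1 + 1 + e : ℝ) ^ i * (2 * x.2 + 1 : ℝ) ^ k *
    exp (-((2 * x.1 + 1 + e) * (2 * x.2 + 1) * β)) * 1 := by
        gcongr
        · exact hσ _ _
        · exact abs_sin_le_one _
    _ = _ := by unfold lambertBound; ring

lemma summable_lambertTerm {e : ℕ} {σ : ℕ → ℕ → ℝ} (hσ : ∀ m l, |σ m l| ≤ 1) (i k j : ℕ)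
    (u : ℝ) {β : ℝ} (hβ : 0 < β) : Summable (lambertTerm e σ i k j u β) :=
  Summable.of_norm_bounded (summable_lambertBound e i k hβ) (norm_lambertTerm_le hσ i k j u β)

lemma hasDerivAt_lambert_left {e : ℕ} {σ : ℕ → ℕ → ℝ} (hσ : ∀ m l, |σ m l| ≤ 1) (i k j : ℕ)
    (u : ℝ) {β : ℝ} (hβ : 0 < β) :
    HasDerivAt (fun u => lambert e σ i k j u β) (lambert e σ (i + 1) k (j + 1) u β) u := by
  refine hasDerivAt_tsum_of_isPreconnected (𝕜 := ℝ) (F := ℝ)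
    (g := fun x u => lambertTerm e σ i k j u β x)
    (g' := fun x u => lambertTerm e σ (i + 1) k (j + 1) u β x)
    (summable_lambertBound e (i + 1) k hβ) isOpen_univ isPreconnected_univ
    (fun x u _ => ?_) (fun x u _ => norm_lambertTerm_le hσ _ _ _ _ _ _) (Set.mem_univ u)
    (summable_lambertTerm hσ i k j u hβ) (Set.mem_univ u)
  unfold lambertTerm
  have h1 : HasDerivAt (fun u : ℝ => (2 * x.1 + 1 + e : ℝ) * u + j * (π / 2))
      (2 * x.1 + 1 + e) u := by
    simpa using ((hasDerivAt_id u).const_mul (2 * x.1 + 1 + e : ℝ)).add_const (j * (π / 2))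
  have h2 := (h1.sin).const_mul (σ x.1 x.2 * (2 * x.1 + 1 + e : ℝ) ^ i * (2 * x.2 + 1 : ℝ) ^ k *
    exp (-((2 * x.1 + 1 + e) * (2 * x.2 + 1) * β)))
  convert! h2 using 1
  have h3 : (2 * x.1 + 1 + e : ℝ) * u + ((j + 1 : ℕ) : ℝ) * (π / 2) =
    ((2 * x.1 + 1 + e : ℝ) * u + j * (π / 2)) + π / 2 := by push_cast; ring
  rw [h3, sin_add_pi_div_two]
  ring

lemma hasDerivAt_lambert_right {e : ℕ} {σ : ℕ → ℕ → ℝ} (hσ : ∀ m l, |σ m l| ≤ 1) (i k j : ℕ)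
    (u : ℝ) {β : ℝ} (hβ : 0 < β) :
    HasDerivAt (fun β => lambert e σ i k j u β) (-lambert e σ (i + 1) (k + 1) j u β) β := by
  have hβ2 : 0 < β / 2 := by positivity
  unfold lambert
  rw [← tsum_neg]
  refine hasDerivAt_tsum_of_isPreconnected (𝕜 := ℝ) (F := ℝ)
    (g := fun x β => lambertTerm e σ i k j u β x)
    (g' := fun x β => -lambertTerm e σ (i + 1) (k + 1) j u β x) (t := Set.Ioi (β / 2))
    (summable_lambertBound e (i + 1) (k + 1) hβ2) isOpen_Ioi isPreconnected_Ioi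
    (fun x β _ => ?_) (fun x β' hb => ?_) (Set.mem_Ioi.mpr (by linarith : β / 2 < β))
    (summable_lambertTerm hσ i k j u hβ) (Set.mem_Ioi.mpr (by linarith : β / 2 < β))
  · unfold lambertTerm
    have h1 : HasDerivAt (fun β : ℝ => -((2 * x.1 + 1 + e : ℝ) * (2 * x.2 + 1) * β))
        (-((2 * x.1 + 1 + e) * (2 * x.2 + 1))) β := by
      simpa using ((hasDerivAt_id β).const_mul ((2 * x.1 + 1 + e : ℝ) * (2 * x.2 + 1))).fun_neg
    have h2 := ((h1.exp).const_mul
      (σ x.1 x.2 * (2 * x.1 + 1 + e : ℝ) ^ i * (2 * x.2 + 1 : ℝ) ^ k)).mul_const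
      (sin ((2 * x.1 + 1 + e) * u + j * (π / 2)))
    convert! h2 using 1
    ring
  · rw [norm_neg]
    exact (norm_lambertTerm_le hσ _ _ _ _ _ _).trans (lambertBound_anti (le_of_lt hb) x)

lemma hasSum_pow_mul_exp_neg_odd {s x : ℝ} (hs : |s| = 1) (hx : 0 < x) :
    HasSum (fun l : ℕ => s ^ l * exp (-((2 * l + 1) * x))) (1 / (exp x - s * exp (-x))) := by
  have hlt : exp (-x) * exp (-x) < 1 := by
    rw [← exp_add, ← exp_zero]; exact exp_lt_exp.mpr (by linarith)
  have hr : |s * (exp (-x) * exp (-x))| < 1 := by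
    rw [abs_mul, hs, one_mul, abs_of_pos (by positivity)]; exact hlt
  have h := (hasSum_geometric_of_abs_lt_one hr).mul_left (exp (-x))
  have hne : (1 : ℝ) - s * (exp (-x) * exp (-x)) ≠ 0 := by
    have := (abs_lt.mp hr).2
    linarith
  convert! h using 1
  · funext l
    rw [mul_pow, ← exp_add, ← exp_nat_mul, mul_left_comm, ← exp_add]
    congr 2; ring
  · have h2 : exp x = (exp (-x))⁻¹ := by rw [← exp_neg, neg_neg]
    have h3 : exp (-x) ≠ 0 := (exp_pos _).ne'
    rw [h2]
    generalize exp (-x) = F at *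
    have h4 : F⁻¹ - s * F = F⁻¹ * (1 - s * (F * F)) := by field_simp
    rw [h4]
    field_simp

lemma hasSum_odd_mul_pow_mul_exp_neg_odd {s x : ℝ} (hs : |s| = 1) (hx : 0 < x) :
    HasSum (fun l : ℕ => s ^ l * (2 * l + 1) * exp (-((2 * l + 1) * x)))
      ((exp x + s * exp (-x)) / (exp x - s * exp (-x)) ^ 2) := by
  have hlt : exp (-x) * exp (-x) < 1 := by
    rw [← exp_add, ← exp_zero]; exact exp_lt_exp.mpr (by linarith)
  have hr : |s * (exp (-x) * exp (-x))| < 1 := by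
    rw [abs_mul, hs, one_mul, abs_of_pos (by positivity)]; exact hlt
  have h1 := (hasSum_coe_mul_geometric_of_norm_lt_one hr).mul_left (2 * exp (-x))
  have h := h1.add (hasSum_pow_mul_exp_neg_odd hs hx)
  have hne : (1 : ℝ) - s * (exp (-x) * exp (-x)) ≠ 0 := by
    have := (abs_lt.mp hr).2
    linarith
  convert! h using 1
  · funext l
    have : exp (-((2 * l + 1) * x)) = exp (-x) * (exp (-x) * exp (-x)) ^ l := by
      rw [← exp_add, ← exp_nat_mul, ← exp_add]; congr 1; ring
    rw [mul_pow, this]; ring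
  · have h2 : exp x = (exp (-x))⁻¹ := by rw [← exp_neg, neg_neg]
    have h3 : exp (-x) ≠ 0 := (exp_pos _).ne'
    rw [h2]
    generalize exp (-x) = F at *
    have h4 : F⁻¹ - s * F = F⁻¹ * (1 - s * (F * F)) := by field_simp
    rw [h4]
    field_simp
    ring

lemma hasSum_sech {x : ℝ} (hx : 0 < x) :
    HasSum (fun l : ℕ => (-1) ^ l * exp (-((2 * l + 1) * x))) (1 / (2 * cosh x)) := by
  convert! hasSum_pow_mul_exp_neg_odd (s := -1) (by simp) hx using 1
  rw [cosh_eq]; congr 1; ring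

lemma hasSum_sech_mul_tanh {x : ℝ} (hx : 0 < x) :
    HasSum (fun l : ℕ => (-1) ^ l * (2 * l + 1) * exp (-((2 * l + 1) * x)))
      (sinh x / (2 * cosh x ^ 2)) := by
  convert! hasSum_odd_mul_pow_mul_exp_neg_odd (s := -1) (by simp) hx using 1
  have : exp x + exp (-x) ≠ 0 := by positivity
  rw [cosh_eq, sinh_eq, show exp x - -1 * exp (-x) = exp x + exp (-x) by ring]
  field_simp
  ring

lemma hasSum_csch {x : ℝ} (hx : 0 < x) :
    HasSum (fun l : ℕ => exp (-((2 * l + 1) * x))) (1 / (2 * sinh x)) := by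
  convert! hasSum_pow_mul_exp_neg_odd (s := 1) (by simp) hx using 1
  · simp
  · rw [sinh_eq]; congr 1; ring

lemma hasSum_csch_mul_coth {x : ℝ} (hx : 0 < x) :
    HasSum (fun l : ℕ => (2 * l + 1) * exp (-((2 * l + 1) * x)))
      (cosh x / (2 * sinh x ^ 2)) := by
  convert! hasSum_odd_mul_pow_mul_exp_neg_odd (s := 1) (by simp) hx using 1
  · simp
  · have : exp x - exp (-x) ≠ 0 := by
      have := exp_lt_exp.mpr (by linarith : -x < x)
      linarith
    rw [cosh_eq, sinh_eq, show exp x - 1 * exp (-x) = exp x - exp (-x) by ring]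
    field_simp

lemma hasSum_lambert_inner {e : ℕ} {σ : ℕ → ℕ → ℝ} (hσ : ∀ m l, |σ m l| ≤ 1) {i k j : ℕ}
    {u β : ℝ} (hβ : 0 < β) {c : ℕ → ℝ}
    (hc : ∀ m : ℕ, HasSum (fun l : ℕ => σ m l * (2 * l + 1 : ℝ) ^ k *
      exp (-((2 * m + 1 + e) * (2 * l + 1) * β))) (c m)) :
    HasSum (fun m : ℕ => c m * (2 * m + 1 + e : ℝ) ^ i * sin ((2 * m + 1 + e) * u + j * (π / 2)))
      (lambert e σ i k j u β) := by
  refine (summable_lambertTerm hσ i k j u hβ).hasSum.prod_fiberwise (fun m => ?_)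
  convert! (hc m).mul_right ((2 * m + 1 + e : ℝ) ^ i * sin ((2 * m + 1 + e) * u + j * (π / 2)))
    using 1
  · funext l
    unfold lambertTerm
    ring
  · ring

open Complex in
lemma hasSum_lambert_exp {e : ℕ} {σ : ℕ → ℕ → ℝ} (hσ : ∀ m l, |σ m l| ≤ 1) {i k : ℕ} (j : ℕ)
    {u β : ℝ} (hβ : 0 < β) {c : ℕ → ℝ}
    (hc : ∀ m : ℕ, HasSum (fun l : ℕ => σ m l * (2 * l + 1 : ℝ) ^ k *
      Real.exp (-((2 * m + 1 + e) * (2 * l + 1) * β))) (c m)) :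
    HasSum (fun m : ℕ => (c m * (2 * m + 1 + e) ^ i * I ^ j : ℂ) * cexp (I * (2 * m + 1 + e) * u))
      (lambert e σ i k (j + 1) u β + I * lambert e σ i k j u β : ℂ) ∧
    HasSum (fun m : ℕ => (c m * (2 * m + 1 + e) ^ i * (-I) ^ j : ℂ) *
        cexp (-(I * (2 * m + 1 + e) * u)))
      (lambert e σ i k (j + 1) u β - I * lambert e σ i k j u β : ℂ) := by
  have h0 := hasSum_ofReal.mpr (hasSum_lambert_inner (i := i) (j := j) (u := u) hσ hβ hc)
  have h1 := hasSum_ofReal.mpr (hasSum_lambert_inner (i := i) (j := j + 1) (u := u) hσ hβ hc)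
  have hI : I ^ j = cexp (j * (π / 2) * I) := by
    rw [mul_assoc, Complex.exp_nat_mul, exp_pi_div_two_mul_I]
  have hI' : (-I) ^ j = cexp (-(j * (π / 2) * I)) := by
    rw [← inv_I, inv_pow, hI, ← Complex.exp_neg]
  constructor
  · convert! h1.add (h0.mul_left I) using 1
    funext m
    have : cexp (I * (2 * m + 1 + e) * u) * I ^ j =
        cexp (((2 * m + 1 + e) * u + j * (π / 2)) * I) := by
      rw [hI, ← Complex.exp_add]; congr 1; ring
    have e1 : (2 * m + 1 + e : ℝ) * u + ((j + 1 : ℕ) : ℝ) * (π / 2) =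
      ((2 * m + 1 + e) * u + j * (π / 2)) + π / 2 := by push_cast; ring
    rw [e1, Real.sin_add_pi_div_two, mul_assoc, mul_comm (I ^ j), this, Complex.exp_mul_I]
    push_cast
    ring
  · convert! h1.sub (h0.mul_left I) using 1
    funext m
    have : cexp (-(I * (2 * m + 1 + e) * u)) * (-I) ^ j =
        cexp (-((2 * m + 1 + e) * u + j * (π / 2)) * I) := by
      rw [hI', ← Complex.exp_add]; congr 1; ring
    have e1 : (2 * m + 1 + e : ℝ) * u + ((j + 1 : ℕ) : ℝ) * (π / 2) =
      ((2 * m + 1 + e) * u + j * (π / 2)) + π / 2 := by push_cast; ring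
    rw [e1, Real.sin_add_pi_div_two, mul_assoc, mul_comm ((-I) ^ j), this, Complex.exp_mul_I,
      Complex.cos_neg, Complex.sin_neg]
    push_cast
    ring

open Complex in
lemma hasSum_lambert_odd {σ : ℕ → ℕ → ℝ} (hσ : ∀ m l, |σ m l| ≤ 1) {i k j : ℕ}
    {u β : ℝ} (hβ : 0 < β) {c : ℕ → ℝ}
    (hc : ∀ m : ℕ, HasSum (fun l : ℕ => σ m l * (2 * l + 1 : ℝ) ^ k *
      Real.exp (-((2 * m + 1) * (2 * l + 1) * β))) (c m)) {a : ℤ → ℂ}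
    (ha : ∀ m : ℕ, a m = -2 * I * (c m * (2 * m + 1) ^ i * I ^ j))
    (ha' : ∀ m : ℕ, a (-(m + 1)) = 2 * I * (c m * (2 * m + 1) ^ i * (-I) ^ j)) :
    HasSum (fun m : ℤ => a m * cexp (I * (2 * m + 1) * u)) (4 * lambert 0 σ i k j u β : ℝ) := by
  obtain ⟨h1, h2⟩ := hasSum_lambert_exp (e := 0) (i := i) (u := u) hσ j hβ (by simpa using hc)
  have h := HasSum.of_nat_of_neg_add_one (f := fun m : ℤ => a m * cexp (I * (2 * m + 1) * u))
    (m := -2 * I * (lambert 0 σ i k (j + 1) u β + I * lambert 0 σ i k j u β))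
    (m' := 2 * I * (lambert 0 σ i k (j + 1) u β - I * lambert 0 σ i k j u β))
    (by
      convert! h1.mul_left (-2 * I) using 1
      funext m
      rw [ha]
      push_cast
      ring_nf)
    (by
      convert! h2.mul_left (2 * I) using 1
      funext m
      rw [ha']
      push_cast
      ring_nf)
  convert! h using 1
  push_cast
  linear_combination (4 * (lambert 0 σ i k j u β : ℂ)) * I_mul_I

open Complex in
lemma hasSum_lambert_even {σ : ℕ → ℕ → ℝ} (hσ : ∀ m l, |σ m l| ≤ 1) {i k j : ℕ}
    {u β : ℝ} (hβ : 0 < β) {c : ℕ → ℝ}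
    (hc : ∀ m : ℕ, HasSum (fun l : ℕ => σ m l * (2 * l + 1 : ℝ) ^ k *
      Real.exp (-((2 * m + 2) * (2 * l + 1) * β))) (c m)) {a : ℤ → ℂ} (ha0 : a 0 = 0)
    (ha : ∀ m : ℕ, a (m + 1) = -2 * I * (c m * (2 * m + 2) ^ i * I ^ j))
    (ha' : ∀ m : ℕ, a (-(m + 1)) = 2 * I * (c m * (2 * m + 2) ^ i * (-I) ^ j)) :
    HasSum (fun m : ℤ => a m * cexp (I * (2 * m) * u)) (4 * lambert 1 σ i k j u β : ℝ) := by
  have e2 : ∀ m : ℕ, (2 * m + 1 + (1 : ℕ) : ℝ) = 2 * m + 2 := fun m => by push_cast; ring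
  have e3 : ∀ m : ℕ, (2 * m + 1 + (1 : ℕ) : ℂ) = 2 * m + 2 := fun m => by push_cast; ring
  obtain ⟨h1, h2⟩ := hasSum_lambert_exp (e := 1) (i := i) (u := u) hσ j hβ
    (by simpa only [e2] using hc)
  simp only [e3] at h1 h2
  have h := HasSum.of_add_one_of_neg_add_one (f := fun m : ℤ => a m * cexp (I * (2 * m) * u))
    (m := -2 * I * (lambert 1 σ i k (j + 1) u β + I * lambert 1 σ i k j u β))
    (m' := 2 * I * (lambert 1 σ i k (j + 1) u β - I * lambert 1 σ i k j u β))
    (by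
      convert! h1.mul_left (-2 * I) using 1
      funext m
      rw [ha]
      push_cast
      ring_nf)
    (by
      convert! h2.mul_left (2 * I) using 1
      funext m
      rw [ha']
      push_cast
      ring_nf)
  convert! h using 1
  rw [ha0]
  push_cast
  linear_combination (4 * (lambert 1 σ i k j u β : ℂ)) * I_mul_I

/-- The sign of an integer, with value `1` at `0`. -/
def intSign (k : ℤ) : ℝ := if 0 ≤ k then 1 else -1

lemma hasSum_shift_sub_intSign (M : ℤ) :
    HasSum (fun k : ℤ => intSign k - intSign (k - M)) (2 * M) := by
  have key : HasSum (fun k : ℤ => intSign k - intSign (k - 1)) 2 := by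
    have h := hasSum_single (f := fun k : ℤ => intSign k - intSign (k - 1)) 0 (fun k hk => by
      simp only [intSign]
      rcases lt_or_gt_of_ne hk with h | h
      · rw [if_neg (by omega), if_neg (by omega)]; ring
      · rw [if_pos (by omega), if_pos (by omega)]; ring)
    convert h using 1
    norm_num [intSign]
  induction M using Int.induction_on with
  | zero => simp
  | succ n ih =>
    have h2 := (Equiv.subRight (n : ℤ)).hasSum_iff.mpr key
    convert! ih.add h2 using 1
    · funext k
      simp only [Function.comp, Equiv.subRight_apply, sub_sub]
      ring
    · push_cast; ring
  | pred n ih =>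
    have h2 := (Equiv.subRight (-(n : ℤ) - 1)).hasSum_iff.mpr key
    convert! ih.sub h2 using 1
    · funext k
      simp only [Function.comp, Equiv.subRight_apply]
      rw [show k - (-(n : ℤ) - 1) - 1 = k - -(n : ℤ) by ring]
      ring
    · push_cast; ring

lemma hasSum_tanh_sub_intSign {β : ℝ} (hβ : 0 < β) :
    HasSum (fun k : ℤ => tanh ((2 * k + 1) * β) - intSign k) 0 := by
  have hs : Summable fun m : ℕ => tanh ((2 * m + 1) * β) - 1 := by
    refine Summable.of_norm_bounded (hasSum_csch hβ).summable (fun m => ?_)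
    have hc : 1 ≤ cosh ((2 * m + 1) * β) := one_le_cosh _
    have : tanh ((2 * m + 1) * β) - 1 = -(exp (-((2 * m + 1) * β)) / cosh ((2 * m + 1) * β)) := by
      rw [tanh_eq_sinh_div_cosh, ← cosh_sub_sinh]
      field_simp
      ring
    rw [this, norm_neg, norm_of_nonneg (by positivity)]
    exact div_le_self (exp_pos _).le hc
  have h := HasSum.of_nat_of_neg_add_one
    (f := fun k : ℤ => tanh ((2 * k + 1) * β) - intSign k) (by simpa [intSign] using hs.hasSum)
    (m' := -∑' m : ℕ, (tanh ((2 * m + 1) * β) - 1)) (by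
      convert! hs.hasSum.neg using 1
      funext m
      have : (2 * ((-((m : ℤ) + 1) : ℤ) : ℝ) + 1) * β = -((2 * m + 1) * β) := by push_cast; ring
      rw [this, tanh_neg, intSign, if_neg (by omega)]
      ring)
  simpa using h

lemma hasSum_coth_sub_intSign {β : ℝ} (hβ : 0 < β) :
    HasSum (fun k : ℤ => cosh (2 * k * β) / sinh (2 * k * β) - intSign k) (-1) := by
  have hs : Summable fun m : ℕ => cosh (2 * (m + 1) * β) / sinh (2 * (m + 1) * β) - 1 := by
    have hs2 : 0 < sinh (2 * β) := sinh_pos_iff.mpr (by linarith)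
    refine Summable.of_norm_bounded ((hasSum_csch hβ).summable.mul_left (1 / sinh (2 * β)))
      (fun m => ?_)
    have hle : 2 * β ≤ 2 * (m + 1) * β := by
      have : (0 : ℝ) ≤ m := by positivity
      nlinarith
    have hc : sinh (2 * β) ≤ sinh (2 * (m + 1) * β) := sinh_le_sinh.mpr hle
    have hpos := hs2.trans_le hc
    have : cosh (2 * (m + 1) * β) / sinh (2 * (m + 1) * β) - 1 =
        exp (-(2 * (m + 1) * β)) / sinh (2 * (m + 1) * β) := by
      rw [← cosh_sub_sinh]
      field_simp
    rw [this, norm_of_nonneg (by positivity), one_div, inv_mul_eq_div]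
    have : exp (-(2 * (m + 1) * β)) ≤ exp (-((2 * m + 1) * β)) := by
      apply exp_le_exp.mpr; linarith
    gcongr
  have h := HasSum.of_add_one_of_neg_add_one
    (f := fun k : ℤ => cosh (2 * k * β) / sinh (2 * k * β) - intSign k)
    (m := ∑' m : ℕ, (cosh (2 * (m + 1) * β) / sinh (2 * (m + 1) * β) - 1)) (by
      convert! hs.hasSum using 1
      funext m
      rw [intSign, if_pos (by omega)]
      push_cast
      rfl)
    (m' := -∑' m : ℕ, (cosh (2 * (m + 1) * β) / sinh (2 * (m + 1) * β) - 1)) (by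
      convert! hs.hasSum.neg using 1
      funext m
      have : 2 * ((-((m : ℤ) + 1) : ℤ) : ℝ) * β = -(2 * (m + 1) * β) := by push_cast; ring
      rw [this, cosh_neg, sinh_neg, intSign, if_neg (by omega), div_neg]
      ring)
  convert! h using 1
  simp [intSign]

/-- `∑ sech x sech y` over odd multiples `x`, `y` of `β` with `x + y = 2 M β`. -/
lemma hasSum_sech_mul_sech {β : ℝ} (hβ : 0 < β) {M : ℤ} (hM : M ≠ 0) :
    HasSum (fun k : ℤ => 1 / cosh ((2 * k + 1) * β) * (1 / cosh ((2 * (M - 1 - k : ℤ) + 1) * β)))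
      (2 * M / sinh (2 * M * β)) := by
  have h1 := hasSum_tanh_sub_intSign hβ
  have h2 := (Equiv.subRight M).hasSum_iff.mpr h1
  have h := ((h1.sub h2).add (hasSum_shift_sub_intSign M)).div_const (sinh (2 * M * β))
  convert! h using 1
  · funext k
    simp only [Function.comp, Equiv.subRight_apply]
    have hs : sinh (2 * M * β) ≠ 0 := by
      rw [ne_eq, sinh_eq_zero]
      have : (M : ℝ) ≠ 0 := by exact_mod_cast hM
      positivity
    have e1 : (2 * ((M - 1 - k : ℤ) : ℝ) + 1) * β = 2 * M * β - (2 * k + 1) * β := by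
      push_cast; ring
    have e2 : (2 * ((k - M : ℤ) : ℝ) + 1) * β = (2 * k + 1) * β - 2 * M * β := by
      push_cast; ring
    rw [e1, e2, ← cosh_neg (2 * M * β - (2 * k + 1) * β), neg_sub]
    have hc1 := (cosh_pos ((2 * k + 1) * β)).ne'
    have hc2 := (cosh_pos ((2 * k + 1) * β - 2 * M * β)).ne'
    have e3 : sinh (2 * M * β) = sinh ((2 * k + 1) * β) * cosh ((2 * k + 1) * β - 2 * M * β) -
        cosh ((2 * k + 1) * β) * sinh ((2 * k + 1) * β - 2 * M * β) := by
      rw [← sinh_sub]; congr 1; ring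
    have e4 : tanh ((2 * k + 1) * β) - tanh ((2 * k + 1) * β - 2 * M * β) =
        sinh (2 * M * β) / (cosh ((2 * k + 1) * β) * cosh ((2 * k + 1) * β - 2 * M * β)) := by
      rw [tanh_eq_sinh_div_cosh, tanh_eq_sinh_div_cosh, e3]
      field_simp
    rw [show tanh ((2 * k + 1) * β) - intSign k - (tanh ((2 * k + 1) * β - 2 * M * β) -
      intSign (k - M)) + (intSign k - intSign (k - M)) =
      tanh ((2 * k + 1) * β) - tanh ((2 * k + 1) * β - 2 * M * β) by ring, e4]
    field_simp
  · ring

/-- `∑ csch x sech y` over even multiples `x` and odd multiples `y` of `β` with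
`x + y = (2 N + 1) β`. -/
lemma hasSum_csch_mul_sech {β : ℝ} (hβ : 0 < β) (N : ℤ) :
    HasSum (fun k : ℤ => 1 / sinh (2 * k * β) * (1 / cosh ((2 * (N - k : ℤ) + 1) * β)))
      ((2 * N + 1 - tanh ((2 * N + 1) * β)) / cosh ((2 * N + 1) * β)) := by
  have h1 := hasSum_tanh_sub_intSign hβ
  have h2 := (Equiv.subRight (N + 1)).hasSum_iff.mpr h1
  have h3 := hasSum_ite_eq (0 : ℤ) (tanh ((2 * N + 1) * β))
  have h := ((((hasSum_coth_sub_intSign hβ).sub h2).add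
    (hasSum_shift_sub_intSign (N + 1))).sub h3).div_const (cosh ((2 * N + 1) * β))
  convert! h using 1
  · funext k
    simp only [Function.comp, Equiv.subRight_apply]
    have e1 : (2 * ((N - k : ℤ) : ℝ) + 1) * β = (2 * N + 1) * β - 2 * k * β := by
      push_cast; ring
    have e2 : (2 * ((k - (N + 1) : ℤ) : ℝ) + 1) * β = 2 * k * β - (2 * N + 1) * β := by
      push_cast; ring
    rw [e1, e2, ← cosh_neg ((2 * N + 1) * β - 2 * k * β), neg_sub]
    rcases eq_or_ne k 0 with rfl | hk
    · simp [tanh_neg]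
      ring
    · rw [if_neg hk]
      have hc1 := (cosh_pos ((2 * N + 1) * β)).ne'
      have hc2 := (cosh_pos (2 * k * β - (2 * N + 1) * β)).ne'
      have hs : sinh (2 * k * β) ≠ 0 := by
        rw [ne_eq, sinh_eq_zero]
        have : (k : ℝ) ≠ 0 := by exact_mod_cast hk
        positivity
      have e3 : cosh ((2 * N + 1) * β) = cosh (2 * k * β) * cosh (2 * k * β - (2 * N + 1) * β) -
          sinh (2 * k * β) * sinh (2 * k * β - (2 * N + 1) * β) := by
        rw [← cosh_sub]; congr 1; ring
      have e4 : cosh (2 * k * β) / sinh (2 * k * β) - tanh (2 * k * β - (2 * N + 1) * β) =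
          cosh ((2 * N + 1) * β) / (sinh (2 * k * β) * cosh (2 * k * β - (2 * N + 1) * β)) := by
        rw [tanh_eq_sinh_div_cosh, e3]
        field_simp
      rw [show cosh (2 * k * β) / sinh (2 * k * β) - intSign k -
        (tanh (2 * k * β - (2 * N + 1) * β) - intSign (k - (N + 1))) +
        (intSign k - intSign (k - (N + 1))) - 0 =
        cosh (2 * k * β) / sinh (2 * k * β) - tanh (2 * k * β - (2 * N + 1) * β) by ring, e4]
      field_simp
  · push_cast; ring

/-- `∑ csch x csch y` over nonzero even multiples `x`, `y` of `β` with `x + y = 2 M β`. -/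
lemma hasSum_csch_mul_csch {β : ℝ} (hβ : 0 < β) {M : ℤ} (hM : M ≠ 0) :
    HasSum (fun k : ℤ => 1 / sinh (2 * k * β) * (1 / sinh (2 * (M - k : ℤ) * β)))
      ((2 * M - 2 * (cosh (2 * M * β) / sinh (2 * M * β))) / sinh (2 * M * β)) := by
  have h1 := hasSum_coth_sub_intSign hβ
  have h2 := (Equiv.subRight M).hasSum_iff.mpr h1
  have h3 := hasSum_ite_eq (0 : ℤ) (cosh (2 * M * β) / sinh (2 * M * β))
  have h4 := hasSum_ite_eq M (cosh (2 * M * β) / sinh (2 * M * β))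
  have h := ((((h1.sub h2).add (hasSum_shift_sub_intSign M)).sub h3).sub h4).div_const
    (sinh (2 * M * β))
  have hs {k : ℤ} (hk : k ≠ 0) : sinh (2 * k * β) ≠ 0 := by
    rw [ne_eq, sinh_eq_zero]
    have : (k : ℝ) ≠ 0 := by exact_mod_cast hk
    positivity
  convert! h using 1
  · funext k
    simp only [Function.comp, Equiv.subRight_apply]
    rcases eq_or_ne k 0 with rfl | hk
    · rw [if_pos rfl, if_neg hM.symm]
      have : 2 * ((0 - M : ℤ) : ℝ) * β = -(2 * M * β) := by push_cast; ring
      rw [this, cosh_neg, sinh_neg]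
      simp
      rw [div_neg]
      ring
    rcases eq_or_ne k M with rfl | hkM
    · rw [if_neg hk, if_pos rfl]
      simp
    rw [if_neg hk, if_neg hkM]
    have e1 : 2 * ((M - k : ℤ) : ℝ) * β = -(2 * (k - M : ℤ) * β) := by push_cast; ring
    rw [e1, sinh_neg]
    have hs1 := hs hk
    have hs2 := hs (sub_ne_zero.mpr hkM)
    have hs3 := hs hM
    have e3 : sinh (2 * M * β) = sinh (2 * k * β) * cosh (2 * (k - M : ℤ) * β) -
        cosh (2 * k * β) * sinh (2 * (k - M : ℤ) * β) := by
      rw [← sinh_sub]; congr 1; push_cast; ring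
    have e4 : cosh (2 * k * β) / sinh (2 * k * β) -
        cosh (2 * (k - M : ℤ) * β) / sinh (2 * (k - M : ℤ) * β) =
        -sinh (2 * M * β) / (sinh (2 * k * β) * sinh (2 * (k - M : ℤ) * β)) := by
      rw [e3]
      field_simp
      ring
    rw [show cosh (2 * k * β) / sinh (2 * k * β) - intSign k -
      (cosh (2 * (k - M : ℤ) * β) / sinh (2 * (k - M : ℤ) * β) - intSign (k - M)) +
      (intSign k - intSign (k - M)) - 0 - 0 = cosh (2 * k * β) / sinh (2 * k * β) -
        cosh (2 * (k - M : ℤ) * β) / sinh (2 * (k - M : ℤ) * β) by ring, e4]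
    field_simp
  · ring

lemma hasSum_int_convolution {f g : ℤ → ℂ} {A B : ℂ} (hf : HasSum f A) (hg : HasSum g B) :
    HasSum (fun N : ℤ => ∑' k : ℤ, f k * g (N - k)) (A * B) := by
  have hs := summable_mul_of_summable_norm hf.summable.norm hg.summable.norm
  let e : ℤ × ℤ ≃ ℤ × ℤ :=
    { toFun := fun x => (x.2, x.1 - x.2)
      invFun := fun x => (x.1 + x.2, x.1)
      left_inv := fun x => by simp
      right_inv := fun x => by simp }
  have h := e.hasSum_iff.mpr (hf.mul hg hs)
  exact h.prod_fiberwise fun N => (h.summable.prod_factor N).hasSum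

/-- The coefficient signs `(-1) ^ (m + l)`. -/
def signOdd (m l : ℕ) : ℝ := (-1) ^ (m + l)

/-- The coefficient signs `(-1) ^ m`. -/
def signEven (m _l : ℕ) : ℝ := (-1) ^ m

/-- The Lambert series over odd frequencies. -/
noncomputable def oddSeries (i k j : ℕ) (u β : ℝ) : ℝ := 4 * lambert 0 signOdd i k j u β

/-- The Lambert series over even frequencies. -/
noncomputable def evenSeries (i k j : ℕ) (u β : ℝ) : ℝ := 4 * lambert 1 signEven i k j u β

lemma abs_signOdd_le (m l : ℕ) : |signOdd m l| ≤ 1 := by simp [signOdd]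

lemma abs_signEven_le (m l : ℕ) : |signEven m l| ≤ 1 := by simp [signEven]

lemma neg_one_zpow_neg_add_one (m : ℕ) : (-1 : ℂ) ^ (-((m : ℤ) + 1)) = -(-1) ^ m := by
  rw [zpow_neg, zpow_add_one₀ (by simp), zpow_natCast]
  rcases neg_one_pow_eq_or ℂ m with h | h <;> rw [h] <;> norm_num

lemma hasSum_signOdd {β : ℝ} (hβ : 0 < β) (m : ℕ) :
    HasSum (fun l : ℕ => signOdd m l * (2 * l + 1 : ℝ) ^ 0 *
      exp (-((2 * m + 1) * (2 * l + 1) * β))) ((-1) ^ m * (1 / (2 * cosh ((2 * m + 1) * β)))) := by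
  convert! (hasSum_sech (x := (2 * m + 1) * β) (by positivity)).mul_left ((-1) ^ m) using 1
  funext l
  rw [signOdd, pow_add, pow_zero, mul_one, mul_assoc]
  congr 4
  ring

lemma hasSum_signOdd_mul {β : ℝ} (hβ : 0 < β) (m : ℕ) :
    HasSum (fun l : ℕ => signOdd m l * (2 * l + 1 : ℝ) ^ 1 *
      exp (-((2 * m + 1) * (2 * l + 1) * β)))
      ((-1) ^ m * (sinh ((2 * m + 1) * β) / (2 * cosh ((2 * m + 1) * β) ^ 2))) := by
  convert! (hasSum_sech_mul_tanh (x := (2 * m + 1) * β) (by positivity)).mul_left ((-1) ^ m)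
    using 1
  funext l
  rw [show (2 * m + 1) * (2 * l + 1) * β = (2 * l + 1) * ((2 * m + 1) * β) by ring, signOdd,
    pow_add]
  ring

lemma hasSum_signEven {β : ℝ} (hβ : 0 < β) (m : ℕ) :
    HasSum (fun l : ℕ => signEven m l * (2 * l + 1 : ℝ) ^ 0 *
      exp (-((2 * m + 2) * (2 * l + 1) * β))) ((-1) ^ m * (1 / (2 * sinh ((2 * m + 2) * β)))) := by
  convert! (hasSum_csch (x := (2 * m + 2) * β) (by positivity)).mul_left ((-1) ^ m) using 1
  funext l
  rw [signEven, pow_zero, mul_one]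
  congr 3
  ring

lemma hasSum_signEven_mul {β : ℝ} (hβ : 0 < β) (m : ℕ) :
    HasSum (fun l : ℕ => signEven m l * (2 * l + 1 : ℝ) ^ 1 *
      exp (-((2 * m + 2) * (2 * l + 1) * β)))
      ((-1) ^ m * (cosh ((2 * m + 2) * β) / (2 * sinh ((2 * m + 2) * β) ^ 2))) := by
  convert! (hasSum_csch_mul_coth (x := (2 * m + 2) * β) (by positivity)).mul_left ((-1) ^ m)
    using 1
  funext l
  rw [signEven, pow_one, mul_assoc]
  congr 4
  ring

open Complex in
lemma hasSum_oddSeries_zero {β : ℝ} (hβ : 0 < β) (u : ℝ) :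
    HasSum (fun k : ℤ => -I * (-1) ^ k * ((1 / Real.cosh ((2 * k + 1) * β) : ℝ) : ℂ) *
      cexp (I * (2 * k + 1) * u)) (oddSeries 0 0 0 u β : ℝ) := by
  refine hasSum_lambert_odd abs_signOdd_le hβ (hasSum_signOdd hβ)
    (a := fun k : ℤ => -I * (-1) ^ k * ((1 / Real.cosh ((2 * k + 1) * β) : ℝ) : ℂ))
    (fun m => ?_) (fun m => ?_)
  · push_cast
    rw [zpow_natCast]
    ring
  · have : (2 * ((-(m + 1) : ℤ) : ℝ) + 1) * β = -((2 * m + 1) * β) := by push_cast; ring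
    rw [this, Real.cosh_neg, neg_one_zpow_neg_add_one]
    push_cast
    ring

open Complex in
lemma hasSum_oddSeries_one {β : ℝ} (hβ : 0 < β) (u : ℝ) :
    HasSum (fun k : ℤ => (-1) ^ k * (2 * k + 1) * ((1 / Real.cosh ((2 * k + 1) * β) : ℝ) : ℂ) *
      cexp (I * (2 * k + 1) * u)) (oddSeries 1 0 1 u β : ℝ) := by
  refine hasSum_lambert_odd abs_signOdd_le hβ (hasSum_signOdd hβ)
    (a := fun k : ℤ => (-1) ^ k * (2 * k + 1) * ((1 / Real.cosh ((2 * k + 1) * β) : ℝ) : ℂ))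
    (fun m => ?_) (fun m => ?_)
  · push_cast
    rw [zpow_natCast]
    ring_nf
    simp
  · have : (2 * ((-(m + 1) : ℤ) : ℝ) + 1) * β = -((2 * m + 1) * β) := by push_cast; ring
    rw [this, Real.cosh_neg, neg_one_zpow_neg_add_one]
    push_cast
    ring_nf
    simp

open Complex in
lemma hasSum_oddSeries_deriv {β : ℝ} (hβ : 0 < β) (u : ℝ) :
    HasSum (fun k : ℤ => -(-1) ^ k *
      ((Real.sinh ((2 * k + 1) * β) / Real.cosh ((2 * k + 1) * β) ^ 2 : ℝ) : ℂ) *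
      cexp (I * (2 * k + 1) * u)) (oddSeries 0 1 3 u β : ℝ) := by
  refine hasSum_lambert_odd abs_signOdd_le hβ (hasSum_signOdd_mul hβ)
    (a := fun k : ℤ => -(-1) ^ k *
      ((Real.sinh ((2 * k + 1) * β) / Real.cosh ((2 * k + 1) * β) ^ 2 : ℝ) : ℂ))
    (fun m => ?_) (fun m => ?_)
  · push_cast
    rw [zpow_natCast, I_pow_three]
    ring_nf
    simp
  · have : (2 * ((-(m + 1) : ℤ) : ℝ) + 1) * β = -((2 * m + 1) * β) := by push_cast; ring
    rw [this, Real.cosh_neg, Real.sinh_neg, neg_one_zpow_neg_add_one, neg_pow I 3, I_pow_three]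
    push_cast
    ring_nf
    simp

open Complex in
lemma hasSum_evenSeries_zero {β : ℝ} (hβ : 0 < β) (u : ℝ) :
    HasSum (fun k : ℤ => I * (-1) ^ k * ((1 / Real.sinh (2 * k * β) : ℝ) : ℂ) *
      cexp (I * (2 * k) * u)) (evenSeries 0 0 0 u β : ℝ) := by
  refine hasSum_lambert_even abs_signEven_le hβ (hasSum_signEven hβ)
    (a := fun k : ℤ => I * (-1) ^ k * ((1 / Real.sinh (2 * k * β) : ℝ) : ℂ))
    (by simp) (fun m => ?_) (fun m => ?_)
  · have : (2 * ((m + 1 : ℤ) : ℝ)) * β = ((2 * m + 2) * β) := by push_cast; ring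
    rw [this, zpow_add_one₀ (by simp), zpow_natCast]
    push_cast
    ring
  · have : (2 * ((-(m + 1) : ℤ) : ℝ)) * β = -((2 * m + 2) * β) := by push_cast; ring
    rw [this, Real.sinh_neg, neg_one_zpow_neg_add_one]
    push_cast
    rw [div_neg]
    ring

open Complex in
lemma hasSum_evenSeries_one {β : ℝ} (hβ : 0 < β) (u : ℝ) :
    HasSum (fun k : ℤ => -(-1) ^ k * (2 * k) * ((1 / Real.sinh (2 * k * β) : ℝ) : ℂ) *
      cexp (I * (2 * k) * u)) (evenSeries 1 0 1 u β : ℝ) := by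
  refine hasSum_lambert_even abs_signEven_le hβ (hasSum_signEven hβ)
    (a := fun k : ℤ => -(-1) ^ k * (2 * k) * ((1 / Real.sinh (2 * k * β) : ℝ) : ℂ))
    (by simp) (fun m => ?_) (fun m => ?_)
  · have : (2 * ((m + 1 : ℤ) : ℝ)) * β = ((2 * m + 2) * β) := by push_cast; ring
    rw [this, zpow_add_one₀ (by simp), zpow_natCast]
    push_cast
    ring_nf
    simp
  · have : (2 * ((-(m + 1) : ℤ) : ℝ)) * β = -((2 * m + 2) * β) := by push_cast; ring
    rw [this, Real.sinh_neg, neg_one_zpow_neg_add_one]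
    push_cast
    rw [div_neg]
    ring_nf
    simp

open Complex in
lemma hasSum_evenSeries_deriv {β : ℝ} (hβ : 0 < β) (u : ℝ) :
    HasSum (fun k : ℤ => (-1) ^ k *
      ((Real.cosh (2 * k * β) / Real.sinh (2 * k * β) ^ 2 : ℝ) : ℂ) *
      cexp (I * (2 * k) * u)) (evenSeries 0 1 3 u β : ℝ) := by
  refine hasSum_lambert_even abs_signEven_le hβ (hasSum_signEven_mul hβ)
    (a := fun k : ℤ => (-1) ^ k *
      ((Real.cosh (2 * k * β) / Real.sinh (2 * k * β) ^ 2 : ℝ) : ℂ))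
    (by simp) (fun m => ?_) (fun m => ?_)
  · have : (2 * ((m + 1 : ℤ) : ℝ)) * β = ((2 * m + 2) * β) := by push_cast; ring
    rw [this, zpow_add_one₀ (by simp), zpow_natCast, I_pow_three]
    push_cast
    ring_nf
    simp
  · have : (2 * ((-(m + 1) : ℤ) : ℝ)) * β = -((2 * m + 2) * β) := by push_cast; ring
    rw [this, Real.sinh_neg, Real.cosh_neg, neg_one_zpow_neg_add_one, neg_pow I 3, I_pow_three]
    push_cast
    ring_nf
    simp

lemma neg_one_zpow_mul_sub (k N : ℤ) : (-1 : ℂ) ^ k * (-1) ^ (N - k) = (-1) ^ N := by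
  rw [← zpow_add₀ (by simp)]
  congr 1
  ring

open Complex in
lemma sq_oddSeries_add_evenSeries {β : ℝ} (hβ : 0 < β) (u : ℝ) :
    oddSeries 0 0 0 u β ^ 2 + evenSeries 1 0 1 u β = evenSeries 1 0 1 0 β := by
  have key : ∃ C : ℂ, ∀ u : ℝ,
      (oddSeries 0 0 0 u β * oddSeries 0 0 0 u β + evenSeries 1 0 1 u β : ℂ) = C := by
    refine ⟨∑' k : ℤ, -I * (-1) ^ k * ((1 / Real.cosh ((2 * k + 1) * β) : ℝ) : ℂ) *
      (-I * (-1) ^ (-1 - k : ℤ) * ((1 / Real.cosh ((2 * (-1 - k : ℤ) + 1) * β) : ℝ) : ℂ)),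
      fun u => ?_⟩
    have h1 := hasSum_oddSeries_zero hβ u
    have h2 := (Equiv.subRight (1 : ℤ)).hasSum_iff.mpr (hasSum_int_convolution h1 h1)
    have h3 := h2.add (hasSum_evenSeries_one hβ u)
    refine (h3.unique ?_)
    have h4 := hasSum_ite_eq (0 : ℤ) (∑' k : ℤ,
      -I * (-1) ^ k * ((1 / Real.cosh ((2 * k + 1) * β) : ℝ) : ℂ) *
      (-I * (-1) ^ (-1 - k : ℤ) * ((1 / Real.cosh ((2 * (-1 - k : ℤ) + 1) * β) : ℝ) : ℂ)))
    refine h4.congr_fun (fun M => ?_)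
    have e1 : ∀ k : ℤ, -I * (-1) ^ k * ((1 / Real.cosh ((2 * k + 1) * β) : ℝ) : ℂ) *
        cexp (I * (2 * k + 1) * u) * (-I * (-1) ^ (M - 1 - k) *
        ((1 / Real.cosh ((2 * (M - 1 - k : ℤ) + 1) * β) : ℝ) : ℂ) *
        cexp (I * (2 * (M - 1 - k : ℤ) + 1) * u)) =
        -I * (-1) ^ k * ((1 / Real.cosh ((2 * k + 1) * β) : ℝ) : ℂ) *
        (-I * (-1) ^ (M - 1 - k) *
        ((1 / Real.cosh ((2 * (M - 1 - k : ℤ) + 1) * β) : ℝ) : ℂ)) * cexp (I * (2 * M) * u) := by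
      intro k
      rw [mul_mul_mul_comm, ← Complex.exp_add]
      congr 2
      push_cast
      ring
    simp only [Function.comp, Equiv.subRight_apply, e1]
    rcases eq_or_ne M 0 with rfl | hM
    · simp
    · rw [if_neg hM, tsum_mul_right]
      have h5 := (hasSum_ofReal.mpr (hasSum_sech_mul_sech hβ hM)).mul_left (-(-1 : ℂ) ^ (M - 1))
      have h6 : ∑' k : ℤ, -I * (-1) ^ k * ((1 / Real.cosh ((2 * k + 1) * β) : ℝ) : ℂ) *
        (-I * (-1) ^ (M - 1 - k) *
        ((1 / Real.cosh ((2 * (M - 1 - k : ℤ) + 1) * β) : ℝ) : ℂ)) =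
          -(-1 : ℂ) ^ (M - 1) * ((2 * M / Real.sinh (2 * M * β) : ℝ) : ℂ) := by
        rw [← h5.tsum_eq]
        congr 1
        funext k
        rw [← neg_one_zpow_mul_sub k (M - 1)]
        push_cast
        ring_nf
        simp
      rw [h6, zpow_sub_one₀ (by simp)]
      push_cast
      ring
  obtain ⟨C, hC⟩ := key
  have h0 : oddSeries 0 0 0 0 β = 0 := by simp [oddSeries, lambert, lambertTerm]
  have h1 := (hC u).trans (hC 0).symm
  rw [h0, Complex.ofReal_zero, mul_zero, zero_add] at h1
  norm_cast at h1
  linarith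

open Complex in
lemma evenSeries_mul_oddSeries {β : ℝ} (hβ : 0 < β) (u : ℝ) :
    evenSeries 0 0 0 u β * oddSeries 0 0 0 u β =
      oddSeries 1 0 1 u β + oddSeries 0 1 3 u β := by
  have h3 := hasSum_int_convolution (hasSum_evenSeries_zero hβ u) (hasSum_oddSeries_zero hβ u)
  have h4 := (hasSum_oddSeries_one hβ u).add (hasSum_oddSeries_deriv hβ u)
  have h := h3.unique (h4.congr_fun (fun N => ?_))
  · exact_mod_cast h
  have h5 := ((hasSum_ofReal.mpr (hasSum_csch_mul_sech hβ N)).mul_left ((-1 : ℂ) ^ N)).mul_right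
    (cexp (I * (2 * N + 1) * u))
  have h6 := h5.congr_fun (g := fun k : ℤ => I * (-1) ^ k * ((1 / Real.sinh (2 * k * β) : ℝ) : ℂ) *
      cexp (I * (2 * k) * u) * (-I * (-1) ^ (N - k) *
      ((1 / Real.cosh ((2 * (N - k : ℤ) + 1) * β) : ℝ) : ℂ) *
      cexp (I * (2 * (N - k : ℤ) + 1) * u))) (fun k => by
    rw [mul_mul_mul_comm, ← Complex.exp_add, ← neg_one_zpow_mul_sub k N]
    congr 1
    · push_cast
      ring_nf
      simp
    · congr 1
      push_cast
      ring)
  rw [h6.tsum_eq, Real.tanh_eq_sinh_div_cosh]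
  have := (Complex.ofReal_ne_zero.mpr (Real.cosh_pos ((2 * N + 1) * β)).ne')
  push_cast at this ⊢
  field_simp
  ring

open Complex in
lemma exists_sq_evenSeries {β : ℝ} (hβ : 0 < β) : ∃ K : ℝ, ∀ u : ℝ,
    evenSeries 0 0 0 u β ^ 2 = evenSeries 1 0 1 u β + 2 * evenSeries 0 1 3 u β + K := by
  have key : ∃ C : ℂ, ∀ u : ℝ, (evenSeries 0 0 0 u β * evenSeries 0 0 0 u β : ℂ) =
      evenSeries 1 0 1 u β + 2 * evenSeries 0 1 3 u β + C := by
    refine ⟨∑' k : ℤ, I * (-1) ^ k * ((1 / Real.sinh (2 * k * β) : ℝ) : ℂ) *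
      (I * (-1) ^ (-k : ℤ) * ((1 / Real.sinh (2 * (-k : ℤ) * β) : ℝ) : ℂ)), fun u => ?_⟩
    have h1 := hasSum_evenSeries_zero hβ u
    refine (hasSum_int_convolution h1 h1).unique ?_
    have h4 := hasSum_ite_eq (0 : ℤ) (∑' k : ℤ, I * (-1) ^ k *
      ((1 / Real.sinh (2 * k * β) : ℝ) : ℂ) *
      (I * (-1) ^ (-k : ℤ) * ((1 / Real.sinh (2 * (-k : ℤ) * β) : ℝ) : ℂ)))
    refine (((hasSum_evenSeries_one hβ u).add
      ((hasSum_evenSeries_deriv hβ u).mul_left 2)).add h4).congr_fun (fun M => ?_)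
    have e1 : ∀ k : ℤ, I * (-1) ^ k * ((1 / Real.sinh (2 * k * β) : ℝ) : ℂ) *
        cexp (I * (2 * k) * u) * (I * (-1) ^ (M - k) *
        ((1 / Real.sinh (2 * (M - k : ℤ) * β) : ℝ) : ℂ) * cexp (I * (2 * (M - k : ℤ)) * u)) =
        I * (-1) ^ k * ((1 / Real.sinh (2 * k * β) : ℝ) : ℂ) *
        (I * (-1) ^ (M - k) * ((1 / Real.sinh (2 * (M - k : ℤ) * β) : ℝ) : ℂ)) *
        cexp (I * (2 * M) * u) := by
      intro k
      rw [mul_mul_mul_comm, ← Complex.exp_add]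
      congr 2
      push_cast
      ring
    simp only [e1]
    rcases eq_or_ne M 0 with rfl | hM
    · simp
    · rw [if_neg hM, tsum_mul_right]
      have h5 := (hasSum_ofReal.mpr (hasSum_csch_mul_csch hβ hM)).mul_left (-(-1 : ℂ) ^ M)
      have h6 : ∑' k : ℤ, I * (-1) ^ k * ((1 / Real.sinh (2 * k * β) : ℝ) : ℂ) *
        (I * (-1) ^ (M - k) * ((1 / Real.sinh (2 * (M - k : ℤ) * β) : ℝ) : ℂ)) =
          -(-1 : ℂ) ^ M * (((2 * M - 2 * (Real.cosh (2 * M * β) / Real.sinh (2 * M * β))) /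
            Real.sinh (2 * M * β) : ℝ) : ℂ) := by
        rw [← h5.tsum_eq]
        congr 1
        funext k
        rw [← neg_one_zpow_mul_sub k M]
        push_cast
        ring_nf
        simp
      have hs : Real.sinh (2 * M * β) ≠ 0 := by
        rw [ne_eq, Real.sinh_eq_zero]
        have : (M : ℝ) ≠ 0 := by exact_mod_cast hM
        positivity
      have hs' := Complex.ofReal_ne_zero.mpr hs
      rw [h6]
      push_cast at hs' ⊢
      field_simp
      ring
  obtain ⟨C, hC⟩ := key
  have h0 : evenSeries 0 0 0 0 β = 0 := by simp [evenSeries, lambert, lambertTerm]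
  refine ⟨-(evenSeries 1 0 1 0 β + 2 * evenSeries 0 1 3 0 β), fun u => ?_⟩
  have h1 := hC u
  have h2 := hC 0
  rw [h0, Complex.ofReal_zero] at h2
  have h3 : (evenSeries 0 0 0 u β * evenSeries 0 0 0 u β : ℂ) = evenSeries 1 0 1 u β +
      2 * evenSeries 0 1 3 u β - (evenSeries 1 0 1 0 β + 2 * evenSeries 0 1 3 0 β) := by
    linear_combination h1 - h2
  norm_cast at h3
  linarith

lemma lambert_add_two (e : ℕ) (σ : ℕ → ℕ → ℝ) (i k j : ℕ) (u β : ℝ) :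
    lambert e σ i k (j + 2) u β = -lambert e σ i k j u β := by
  unfold lambert
  rw [← tsum_neg]
  congr 1
  funext x
  unfold lambertTerm
  have : (2 * x.1 + 1 + e : ℝ) * u + ((j + 2 : ℕ) : ℝ) * (π / 2) =
    ((2 * x.1 + 1 + e : ℝ) * u + j * (π / 2)) + π := by push_cast; ring
  rw [this, sin_add_pi]
  ring

lemma oddSeries_add_two (i k j : ℕ) (u β : ℝ) :
    oddSeries i k (j + 2) u β = -oddSeries i k j u β := by
  rw [oddSeries, oddSeries, lambert_add_two, mul_neg]

lemma evenSeries_add_two (i k j : ℕ) (u β : ℝ) :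
    evenSeries i k (j + 2) u β = -evenSeries i k j u β := by
  rw [evenSeries, evenSeries, lambert_add_two, mul_neg]

lemma oddSeries_apply_zero (i k : ℕ) (β : ℝ) : oddSeries i k 0 0 β = 0 := by
  simp [oddSeries, lambert, lambertTerm]

lemma evenSeries_apply_zero (i k : ℕ) (β : ℝ) : evenSeries i k 0 0 β = 0 := by
  simp [evenSeries, lambert, lambertTerm]

lemma hasDerivAt_oddSeries_left (i k j : ℕ) {β : ℝ} (hβ : 0 < β) (u : ℝ) :
    HasDerivAt (fun u => oddSeries i k j u β) (oddSeries (i + 1) k (j + 1) u β) u :=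
  (hasDerivAt_lambert_left abs_signOdd_le i k j u hβ).const_mul 4

lemma hasDerivAt_evenSeries_left (i k j : ℕ) {β : ℝ} (hβ : 0 < β) (u : ℝ) :
    HasDerivAt (fun u => evenSeries i k j u β) (evenSeries (i + 1) k (j + 1) u β) u :=
  (hasDerivAt_lambert_left abs_signEven_le i k j u hβ).const_mul 4

lemma hasDerivAt_oddSeries_right (i k j : ℕ) {β : ℝ} (hβ : 0 < β) (u : ℝ) :
    HasDerivAt (fun β => oddSeries i k j u β) (-oddSeries (i + 1) (k + 1) j u β) β := by
  convert! (hasDerivAt_lambert_right abs_signOdd_le i k j u hβ).const_mul 4 using 1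
  rw [oddSeries]; ring

lemma hasDerivAt_evenSeries_right (i k j : ℕ) {β : ℝ} (hβ : 0 < β) (u : ℝ) :
    HasDerivAt (fun β => evenSeries i k j u β) (-evenSeries (i + 1) (k + 1) j u β) β := by
  convert! (hasDerivAt_lambert_right abs_signEven_le i k j u hβ).const_mul 4 using 1
  rw [evenSeries]; ring

lemma deriv_eq_of_eq {f g : ℝ → ℝ} (h : ∀ u, f u = g u) {f' g' u : ℝ} (hf : HasDerivAt f f' u)
    (hg : HasDerivAt g g' u) : f' = g' := by
  obtain rfl : f = g := funext h
  exact hf.unique hg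

lemma deriv_eq_of_eq_of_pos {f g : ℝ → ℝ} (h : ∀ u, 0 < u → f u = g u) {f' g' u : ℝ} (hu : 0 < u)
    (hf : HasDerivAt f f' u) (hg : HasDerivAt g g' u) : f' = g' := by
  refine hf.unique (hg.congr_of_eventuallyEq ?_)
  filter_upwards [Ioi_mem_nhds hu] with v hv using h v hv

lemma evenSeries_two_eq {β : ℝ} (hβ : 0 < β) (u : ℝ) :
    evenSeries 2 0 2 u β = -2 * oddSeries 0 0 0 u β * oddSeries 1 0 1 u β := by
  have h := deriv_eq_of_eq (u := u) (sq_oddSeries_add_evenSeries hβ)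
    (((hasDerivAt_oddSeries_left 0 0 0 hβ u).pow 2).add (hasDerivAt_evenSeries_left 1 0 1 hβ u))
    (hasDerivAt_const u _)
  simp only [zero_add, Nat.reduceAdd] at h
  linear_combination h

lemma evenSeries_three_eq {β : ℝ} (hβ : 0 < β) (u : ℝ) :
    evenSeries 3 0 3 u β =
      -2 * oddSeries 1 0 1 u β ^ 2 - 2 * oddSeries 0 0 0 u β * oddSeries 2 0 2 u β := by
  have h := deriv_eq_of_eq (u := u) (evenSeries_two_eq hβ)
    (hasDerivAt_evenSeries_left 2 0 2 hβ u)
    (((hasDerivAt_oddSeries_left 0 0 0 hβ u).const_mul (-2)).mul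
      (hasDerivAt_oddSeries_left 1 0 1 hβ u))
  simp only [zero_add, Nat.reduceAdd] at h
  linear_combination h

lemma oddSeries_heat {β : ℝ} (hβ : 0 < β) (u : ℝ) :
    oddSeries 1 1 0 u β = evenSeries 1 0 1 u β * oddSeries 0 0 0 u β +
      evenSeries 0 0 0 u β * oddSeries 1 0 1 u β - oddSeries 2 0 2 u β := by
  have h := deriv_eq_of_eq (u := u) (evenSeries_mul_oddSeries hβ)
    ((hasDerivAt_evenSeries_left 0 0 0 hβ u).mul (hasDerivAt_oddSeries_left 0 0 0 hβ u))
    ((hasDerivAt_oddSeries_left 1 0 1 hβ u).add (hasDerivAt_oddSeries_left 0 1 3 hβ u))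
  have e : oddSeries 1 1 4 u β = oddSeries 1 1 0 u β := by
    rw [oddSeries_add_two, oddSeries_add_two, neg_neg]
  simp only [zero_add, Nat.reduceAdd, e] at h
  linear_combination -h

lemma evenSeries_heat {β : ℝ} (hβ : 0 < β) (u : ℝ) :
    evenSeries 1 1 0 u β = evenSeries 0 0 0 u β * evenSeries 1 0 1 u β -
      evenSeries 2 0 2 u β / 2 := by
  obtain ⟨K, hK⟩ := exists_sq_evenSeries hβ
  have h := deriv_eq_of_eq (u := u) hK
    ((hasDerivAt_evenSeries_left 0 0 0 hβ u).pow 2)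
    (((hasDerivAt_evenSeries_left 1 0 1 hβ u).add
      ((hasDerivAt_evenSeries_left 0 1 3 hβ u).const_mul 2)).add_const K)
  rw [evenSeries_add_two 1, evenSeries_add_two 1] at h
  simp only [zero_add, Nat.reduceAdd, neg_neg] at h
  linear_combination -h / 2

lemma oddSeries_quadratic_of_series {β : ℝ} (hβ : 0 < β) (u : ℝ) :
    oddSeries 1 0 1 u β ^ 2 - oddSeries 0 0 0 u β * oddSeries 2 0 2 u β - oddSeries 0 0 0 u β ^ 4 =
      evenSeries 2 1 1 0 β - evenSeries 1 0 1 0 β ^ 2 := by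
  have h1 := deriv_eq_of_eq_of_pos (fun β hβ => sq_oddSeries_add_evenSeries hβ u) hβ
    (((hasDerivAt_oddSeries_right 0 0 0 hβ u).pow 2).add (hasDerivAt_evenSeries_right 1 0 1 hβ u))
    (hasDerivAt_evenSeries_right 1 0 1 hβ 0)
  have h2 := deriv_eq_of_eq (u := u) (evenSeries_heat hβ)
    (hasDerivAt_evenSeries_left 1 1 0 hβ u)
    (((hasDerivAt_evenSeries_left 0 0 0 hβ u).mul (hasDerivAt_evenSeries_left 1 0 1 hβ u)).sub
      ((hasDerivAt_evenSeries_left 2 0 2 hβ u).div_const 2))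
  have h3 := oddSeries_heat hβ u
  have h4 := evenSeries_two_eq hβ u
  have h5 := evenSeries_three_eq hβ u
  have h6 := sq_oddSeries_add_evenSeries hβ u
  simp only [zero_add, Nat.reduceAdd] at h1 h2
  rw [h4, h5] at h2
  rw [h2, h3] at h1
  rw [← h6]
  norm_num at h1 ⊢
  linear_combination -h1

/-- The differential equation in `u` for the odd series. -/
lemma oddSeries_quadratic {β : ℝ} (hβ : 0 < β) (u : ℝ) :
    oddSeries 1 0 1 u β ^ 2 - oddSeries 0 0 0 u β * oddSeries 2 0 2 u β - oddSeries 0 0 0 u β ^ 4 =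
      oddSeries 1 0 1 0 β ^ 2 := by
  have h := oddSeries_quadratic_of_series hβ 0
  rw [oddSeries_quadratic_of_series hβ, ← h, oddSeries_apply_zero]
  ring

lemma oddSeries_cubic {β : ℝ} (hβ : 0 < β) (u : ℝ) :
    oddSeries 0 0 0 u β * oddSeries 3 0 3 u β = oddSeries 1 0 1 u β * oddSeries 2 0 2 u β -
      4 * oddSeries 0 0 0 u β ^ 3 * oddSeries 1 0 1 u β := by
  have h := deriv_eq_of_eq (u := u) (oddSeries_quadratic hβ)
    ((((hasDerivAt_oddSeries_left 1 0 1 hβ u).pow 2).sub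
      ((hasDerivAt_oddSeries_left 0 0 0 hβ u).mul (hasDerivAt_oddSeries_left 2 0 2 hβ u))).sub
      ((hasDerivAt_oddSeries_left 0 0 0 hβ u).pow 4)) (hasDerivAt_const u _)
  norm_num at h
  linear_combination -h

lemma oddSeries_five_apply_zero {β : ℝ} (hβ : 0 < β) :
    oddSeries 1 0 1 0 β * oddSeries 5 0 5 0 β =
      oddSeries 3 0 3 0 β ^ 2 - 12 * oddSeries 1 0 1 0 β ^ 4 := by
  have d0 := hasDerivAt_oddSeries_left 0 0 0 hβ
  have d1 := hasDerivAt_oddSeries_left 1 0 1 hβ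
  have d2 := hasDerivAt_oddSeries_left 2 0 2 hβ
  have d3 := hasDerivAt_oddSeries_left 3 0 3 hβ
  have d4 := hasDerivAt_oddSeries_left 4 0 4 hβ
  norm_num at d0 d1 d2 d3 d4
  have h1 (u : ℝ) : oddSeries 0 0 0 u β * oddSeries 4 0 4 u β = oddSeries 2 0 2 u β ^ 2 -
      12 * oddSeries 0 0 0 u β ^ 2 * oddSeries 1 0 1 u β ^ 2 -
      4 * oddSeries 0 0 0 u β ^ 3 * oddSeries 2 0 2 u β := by
    have h := deriv_eq_of_eq (u := u) (oddSeries_cubic hβ) ((d0 u).mul (d3 u))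
      (((d1 u).mul (d2 u)).sub ((((d0 u).pow 3).const_mul 4).mul (d1 u)))
    norm_num at h
    linear_combination h
  have h2 (u : ℝ) : oddSeries 1 0 1 u β * oddSeries 4 0 4 u β +
      oddSeries 0 0 0 u β * oddSeries 5 0 5 u β = 2 * oddSeries 2 0 2 u β * oddSeries 3 0 3 u β -
      24 * oddSeries 0 0 0 u β * oddSeries 1 0 1 u β ^ 3 -
      36 * oddSeries 0 0 0 u β ^ 2 * oddSeries 1 0 1 u β * oddSeries 2 0 2 u β -
      4 * oddSeries 0 0 0 u β ^ 3 * oddSeries 3 0 3 u β := by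
    have h := deriv_eq_of_eq (u := u) h1 ((d0 u).mul (d4 u))
      ((((d2 u).pow 2).sub ((((d0 u).pow 2).const_mul 12).mul ((d1 u).pow 2))).sub
        ((((d0 u).pow 3).const_mul 4).mul (d2 u)))
    norm_num at h
    linear_combination h
  have d5 := hasDerivAt_oddSeries_left 5 0 5 hβ 0
  have h := deriv_eq_of_eq (u := 0) h2 (((d1 0).mul (d4 0)).add ((d0 0).mul d5))
    ((((((d2 0).const_mul 2).mul (d3 0)).sub (((d0 0).const_mul 24).mul ((d1 0).pow 3))).sub
      (((((d0 0).pow 2).const_mul 36).mul (d1 0)).mul (d2 0))).sub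
      ((((d0 0).pow 3).const_mul 4).mul (d3 0)))
  have e2 : oddSeries 2 0 2 0 β = 0 := by rw [oddSeries_add_two, oddSeries_apply_zero, neg_zero]
  have e4 : oddSeries 4 0 4 0 β = 0 := by
    rw [oddSeries_add_two, oddSeries_add_two, oddSeries_apply_zero, neg_zero, neg_zero]
  norm_num [oddSeries_apply_zero, e2, e4] at h
  linear_combination h / 2

lemma oddSeries_two_one_apply_zero {β : ℝ} (hβ : 0 < β) :
    -oddSeries 2 1 1 0 β =
      oddSeries 3 0 3 0 β - 2 * evenSeries 1 0 1 0 β * oddSeries 1 0 1 0 β := by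
  have h := deriv_eq_of_eq (u := 0) (oddSeries_heat hβ) (hasDerivAt_oddSeries_left 1 1 0 hβ 0)
    ((((hasDerivAt_evenSeries_left 1 0 1 hβ 0).mul (hasDerivAt_oddSeries_left 0 0 0 hβ 0)).add
      ((hasDerivAt_evenSeries_left 0 0 0 hβ 0).mul (hasDerivAt_oddSeries_left 1 0 1 hβ 0))).sub
      (hasDerivAt_oddSeries_left 2 0 2 hβ 0))
  norm_num [oddSeries_apply_zero, evenSeries_apply_zero] at h
  linear_combination -h

lemma evenSeries_two_one_apply_zero {β : ℝ} (hβ : 0 < β) :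
    evenSeries 2 1 1 0 β = evenSeries 1 0 1 0 β ^ 2 + oddSeries 1 0 1 0 β ^ 2 := by
  have h := oddSeries_quadratic_of_series hβ 0
  rw [oddSeries_apply_zero] at h
  linear_combination -h

lemma oddSeries_four_one_apply_zero {β : ℝ} (hβ : 0 < β) :
    -oddSeries 4 1 3 0 β = oddSeries 5 0 5 0 β + 8 * oddSeries 1 0 1 0 β ^ 3 -
      4 * evenSeries 1 0 1 0 β * oddSeries 3 0 3 0 β := by
  have d0 := hasDerivAt_oddSeries_left 0 0 0 hβ
  have d1 := hasDerivAt_oddSeries_left 1 0 1 hβ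
  have d2 := hasDerivAt_oddSeries_left 2 0 2 hβ
  have d3 := hasDerivAt_oddSeries_left 3 0 3 hβ
  have d4 := hasDerivAt_oddSeries_left 4 0 4 hβ
  have z0 := hasDerivAt_evenSeries_left 0 0 0 hβ
  have z1 := hasDerivAt_evenSeries_left 1 0 1 hβ
  have z2 := hasDerivAt_evenSeries_left 2 0 2 hβ
  have z3 := hasDerivAt_evenSeries_left 3 0 3 hβ
  norm_num at d0 d1 d2 d3 d4 z0 z1 z2 z3
  have h1 (u : ℝ) : oddSeries 2 1 1 u β = evenSeries 2 0 2 u β * oddSeries 0 0 0 u β +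
      2 * evenSeries 1 0 1 u β * oddSeries 1 0 1 u β +
      evenSeries 0 0 0 u β * oddSeries 2 0 2 u β - oddSeries 3 0 3 u β := by
    have h := deriv_eq_of_eq (u := u) (oddSeries_heat hβ) (hasDerivAt_oddSeries_left 1 1 0 hβ u)
      ((((z1 u).mul (d0 u)).add ((z0 u).mul (d1 u))).sub (d2 u))
    norm_num at h
    linear_combination h
  have h2 (u : ℝ) : oddSeries 3 1 2 u β = evenSeries 3 0 3 u β * oddSeries 0 0 0 u β +
      3 * evenSeries 2 0 2 u β * oddSeries 1 0 1 u β +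
      3 * evenSeries 1 0 1 u β * oddSeries 2 0 2 u β +
      evenSeries 0 0 0 u β * oddSeries 3 0 3 u β - oddSeries 4 0 4 u β := by
    have h := deriv_eq_of_eq (u := u) h1 (hasDerivAt_oddSeries_left 2 1 1 hβ u)
      (((((z2 u).mul (d0 u)).add (((z1 u).const_mul 2).mul (d1 u))).add
        ((z0 u).mul (d2 u))).sub (d3 u))
    norm_num at h
    linear_combination h
  have h := deriv_eq_of_eq (u := 0) h2 (hasDerivAt_oddSeries_left 3 1 2 hβ 0)
    ((((((z3 0).mul (d0 0)).add (((z2 0).const_mul 3).mul (d1 0))).add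
      (((z1 0).const_mul 3).mul (d2 0))).add ((z0 0).mul (d3 0))).sub (d4 0))
  have e2 : oddSeries 2 0 2 0 β = 0 := by rw [oddSeries_add_two, oddSeries_apply_zero, neg_zero]
  have e3 := evenSeries_three_eq hβ 0
  have e4 := evenSeries_two_eq hβ 0
  rw [oddSeries_apply_zero] at e3 e4
  norm_num [oddSeries_apply_zero, evenSeries_apply_zero, e2, e3, e4] at h
  linear_combination -h

/-- The differential equation in `β` for the third derivative at `u = 0`. -/
lemma oddSeries_four_one_mul {β : ℝ} (hβ : 0 < β) :
    oddSeries 1 0 1 0 β * -oddSeries 4 1 3 0 β = oddSeries 3 0 3 0 β ^ 2 -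
      4 * oddSeries 1 0 1 0 β ^ 4 -
      4 * evenSeries 1 0 1 0 β * oddSeries 3 0 3 0 β * oddSeries 1 0 1 0 β := by
  rw [oddSeries_four_one_apply_zero hβ]
  linear_combination oddSeries_five_apply_zero hβ

lemma evenSeries_one_hasDerivAt {β : ℝ} (hβ : 0 < β) :
    HasDerivAt (fun β => evenSeries 1 0 1 0 β)
      (-(evenSeries 1 0 1 0 β ^ 2 + oddSeries 1 0 1 0 β ^ 2)) β := by
  convert! hasDerivAt_evenSeries_right 1 0 1 hβ 0 using 1
  rw [evenSeries_two_one_apply_zero hβ]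

lemma oddSeries_five_two_eq {β : ℝ} (hβ : 0 < β) :
    -oddSeries 2 1 1 0 β * -oddSeries 4 1 3 0 β + oddSeries 1 0 1 0 β * oddSeries 5 2 3 0 β =
      2 * oddSeries 3 0 3 0 β * -oddSeries 4 1 3 0 β
      - 16 * oddSeries 1 0 1 0 β ^ 3 * -oddSeries 2 1 1 0 β
      + 4 * (evenSeries 1 0 1 0 β ^ 2 + oddSeries 1 0 1 0 β ^ 2) * oddSeries 3 0 3 0 β *
        oddSeries 1 0 1 0 β
      - 4 * evenSeries 1 0 1 0 β * -oddSeries 4 1 3 0 β * oddSeries 1 0 1 0 β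
      - 4 * evenSeries 1 0 1 0 β * oddSeries 3 0 3 0 β * -oddSeries 2 1 1 0 β := by
  have p0 := hasDerivAt_oddSeries_right 1 0 1 hβ 0
  have r0 := hasDerivAt_oddSeries_right 3 0 3 hβ 0
  have r1 := (hasDerivAt_oddSeries_right 4 1 3 hβ 0).fun_neg
  have e0 := evenSeries_one_hasDerivAt hβ
  have h := deriv_eq_of_eq_of_pos (fun β hβ => oddSeries_four_one_mul hβ) hβ (p0.mul r1)
    (((r0.pow 2).sub ((p0.pow 4).const_mul 4)).sub (((e0.const_mul 4).mul r0).mul p0))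
  norm_num at h ⊢
  linear_combination h

lemma oddSeries_three_two_eq {β : ℝ} (hβ : 0 < β) :
    oddSeries 3 2 1 0 β = -oddSeries 4 1 3 0 β
      + 2 * (evenSeries 1 0 1 0 β ^ 2 + oddSeries 1 0 1 0 β ^ 2) * oddSeries 1 0 1 0 β
      + 2 * evenSeries 1 0 1 0 β * oddSeries 2 1 1 0 β := by
  have p0 := hasDerivAt_oddSeries_right 1 0 1 hβ 0
  have p1 := (hasDerivAt_oddSeries_right 2 1 1 hβ 0).fun_neg
  have r0 := hasDerivAt_oddSeries_right 3 0 3 hβ 0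
  have e0 := evenSeries_one_hasDerivAt hβ
  have h := deriv_eq_of_eq_of_pos (fun β hβ => oddSeries_two_one_apply_zero hβ) hβ p1
    (r0.sub ((e0.const_mul 2).mul p0))
  norm_num at h ⊢
  linear_combination h

lemma oddSeries_four_three_eq {β : ℝ} (hβ : 0 < β) :
    -oddSeries 4 3 1 0 β = oddSeries 5 2 3 0 β
      - 4 * (evenSeries 1 0 1 0 β ^ 2 + oddSeries 1 0 1 0 β ^ 2) * oddSeries 2 1 1 0 β
      - 4 * evenSeries 1 0 1 0 β * (evenSeries 1 0 1 0 β ^ 2 + oddSeries 1 0 1 0 β ^ 2) *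
        oddSeries 1 0 1 0 β
      - 4 * oddSeries 1 0 1 0 β ^ 2 * oddSeries 2 1 1 0 β
      - 2 * evenSeries 1 0 1 0 β * oddSeries 3 2 1 0 β := by
  have p0 := hasDerivAt_oddSeries_right 1 0 1 hβ 0
  have p1 := hasDerivAt_oddSeries_right 2 1 1 hβ 0
  have p2 := hasDerivAt_oddSeries_right 3 2 1 hβ 0
  have r1 := (hasDerivAt_oddSeries_right 4 1 3 hβ 0).fun_neg
  have e0 := evenSeries_one_hasDerivAt hβ
  have h := deriv_eq_of_eq_of_pos (fun β hβ => oddSeries_three_two_eq hβ) hβ p2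
    ((r1.add ((((e0.pow 2).add (p0.pow 2)).const_mul 2).mul p0)).add ((e0.const_mul 2).mul p1))
  norm_num at h ⊢
  linear_combination h

lemma oddSeries_four_one_of_eq_zero {β : ℝ} (hβ : 0 < β) (hp : oddSeries 1 0 1 0 β ≠ 0)
    (hr : oddSeries 3 0 3 0 β = 0) : oddSeries 4 1 3 0 β = 4 * oddSeries 1 0 1 0 β ^ 3 := by
  have h := oddSeries_four_one_mul hβ
  rw [hr] at h
  apply mul_left_cancel₀ hp
  linear_combination -h

lemma oddSeries_five_two_of_eq_zero {β : ℝ} (hβ : 0 < β) (hp : oddSeries 1 0 1 0 β ≠ 0)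
    (hr : oddSeries 3 0 3 0 β = 0) :
    oddSeries 5 2 3 0 β = 40 * evenSeries 1 0 1 0 β * oddSeries 1 0 1 0 β ^ 3 := by
  have h := oddSeries_five_two_eq hβ
  have h1 := oddSeries_two_one_apply_zero hβ
  rw [hr] at h h1
  rw [h1, oddSeries_four_one_of_eq_zero hβ hp hr] at h
  apply mul_left_cancel₀ hp
  linear_combination h

lemma oddSeries_four_three_of_eq_zero {β : ℝ} (hβ : 0 < β) (hp : oddSeries 1 0 1 0 β ≠ 0)
    (hr : oddSeries 3 0 3 0 β = 0) :
    oddSeries 3 2 1 0 β = -2 * oddSeries 1 0 1 0 β ^ 3 +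
      6 * evenSeries 1 0 1 0 β ^ 2 * oddSeries 1 0 1 0 β ∧
    oddSeries 4 3 1 0 β = 24 * evenSeries 1 0 1 0 β ^ 3 * oddSeries 1 0 1 0 β -
      24 * evenSeries 1 0 1 0 β * oddSeries 1 0 1 0 β ^ 3 := by
  have h1 := oddSeries_two_one_apply_zero hβ
  have h2 := oddSeries_three_two_eq hβ
  have h3 := oddSeries_four_three_eq hβ
  have r1 := oddSeries_four_one_of_eq_zero hβ hp hr
  have r2 := oddSeries_five_two_of_eq_zero hβ hp hr
  rw [hr] at h1
  have h1' : oddSeries 2 1 1 0 β = 2 * evenSeries 1 0 1 0 β * oddSeries 1 0 1 0 β := by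
    linear_combination -h1
  rw [r1, h1'] at h2
  rw [r2, h1', h2] at h3
  constructor
  · linear_combination h2
  · linear_combination -h3

lemma oddSeries_five_four_of_eq_zero {β : ℝ} (hβ : 0 < β) (hp : oddSeries 1 0 1 0 β ≠ 0)
    (hr : oddSeries 3 0 3 0 β = 0) :
    oddSeries 5 4 1 0 β = 8 * oddSeries 1 0 1 0 β ^ 5 -
      240 * evenSeries 1 0 1 0 β ^ 2 * oddSeries 1 0 1 0 β ^ 3 +
      120 * evenSeries 1 0 1 0 β ^ 4 * oddSeries 1 0 1 0 β := by
  have p0 := hasDerivAt_oddSeries_right 1 0 1 hβ 0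
  have p1 := hasDerivAt_oddSeries_right 2 1 1 hβ 0
  have p2 := hasDerivAt_oddSeries_right 3 2 1 hβ 0
  have p3 := (hasDerivAt_oddSeries_right 4 3 1 hβ 0).fun_neg
  have r0 := hasDerivAt_oddSeries_right 3 0 3 hβ 0
  have r1 := (hasDerivAt_oddSeries_right 4 1 3 hβ 0).fun_neg
  have r2 := hasDerivAt_oddSeries_right 5 2 3 hβ 0
  have e0 := evenSeries_one_hasDerivAt hβ
  have q0 := (e0.pow 2).add (p0.pow 2)
  have h1 := deriv_eq_of_eq_of_pos (fun β hβ => oddSeries_four_three_eq hβ) hβ p3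
    ((((r2.sub ((q0.const_mul 4).mul p1)).sub (((e0.const_mul 4).mul q0).mul p0)).sub
      (((p0.pow 2).const_mul 4).mul p1)).sub ((e0.const_mul 2).mul p2))
  have h2 := deriv_eq_of_eq_of_pos (fun β hβ => oddSeries_five_two_eq hβ) hβ
    ((p1.fun_neg.mul r1).add (p0.mul r2))
    ((((((r0.const_mul 2).mul r1).sub (((p0.pow 3).const_mul 16).mul p1.fun_neg)).add
      (((q0.const_mul 4).mul r0).mul p0)).sub (((e0.const_mul 4).mul r1).mul p0)).sub
      (((e0.const_mul 4).mul r0).mul p1.fun_neg))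
  have v0 := oddSeries_two_one_apply_zero hβ
  rw [hr] at v0
  have v1 : oddSeries 2 1 1 0 β = 2 * evenSeries 1 0 1 0 β * oddSeries 1 0 1 0 β := by
    linear_combination -v0
  obtain ⟨v2, v3⟩ := oddSeries_four_three_of_eq_zero hβ hp hr
  have v4 := oddSeries_four_one_of_eq_zero hβ hp hr
  have v5 := oddSeries_five_two_of_eq_zero hβ hp hr
  norm_num at h1 h2
  rw [hr, v1, v2, v4, v5] at h2
  rw [v1, v2, v3] at h1
  apply mul_left_cancel₀ hp
  linear_combination oddSeries 1 0 1 0 β * h1 + h2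

lemma HasSum.int_even_add_odd' {f : ℤ → ℂ} {a b : ℂ} (he : HasSum (fun k => f (2 * k)) a)
    (ho : HasSum (fun k => f (2 * k + 1)) b) : HasSum f (a + b) := by
  have h := mul_right_injective₀ (two_ne_zero' ℤ)
  replace ho := ((add_left_injective 1).comp h).hasSum_range_iff.2 ho
  refine (h.hasSum_range_iff.2 he).add_isCompl ?_ ho
  convert! Int.isCompl_even_odd using 1
  · ext n
    simp [even_iff_exists_two_mul]
  · ext n
    simp [Odd, eq_comm]

/-- The sum of `χ(n) n ^ k exp(- n π y / 2)` for the nontrivial character `χ` modulo `4`. -/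
noncomputable def charSeries (k : ℕ) (y : ℝ) : ℝ :=
  ∑' m : ℕ, (-1) ^ m * (2 * m + 1 : ℝ) ^ k * exp (-((2 * m + 1) * (y * (π / 2))))

open Complex in
lemma hasSum_inv_pow_add_int {k : ℕ} (hk : 1 ≤ k) (z : UpperHalfPlane) :
    HasSum (fun n : ℤ => 1 / ((z : ℂ) + n) ^ (k + 1)) ((-2 * π * I) ^ (k + 1) / k.factorial *
      ∑' n : ℕ, n ^ k * cexp (2 * π * I * z) ^ n) := by
  rw [← EisensteinSeries.qExpansion_identity hk z]
  refine Summable.hasSum ?_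
  convert! EisensteinSeries.linear_right_summable (z : ℂ) 1 (k := (k + 1 : ℕ)) (by omega) using 1
  funext n
  rw [Int.cast_one, one_mul, zpow_natCast, one_div]

open Complex in
lemma hasSum_pow_mul_pow_sub_pow {k : ℕ} {y : ℝ} (hy : 0 < y) :
    HasSum (fun n : ℕ => (n : ℂ) ^ k * (I * Real.exp (-(y * (π / 2)))) ^ n -
      (n : ℂ) ^ k * (-I * Real.exp (-(y * (π / 2)))) ^ n) (2 * I * charSeries k y) := by
  have hs : HasSum (fun m : ℕ => (-1) ^ m * (2 * m + 1 : ℝ) ^ k *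
      Real.exp (-((2 * m + 1) * (y * (π / 2))))) (charSeries k y) := by
    refine Summable.hasSum (Summable.of_norm_bounded
      (summable_affine_pow_mul_exp 0 k (β := y * (π / 2)) (by positivity)) (fun m => ?_))
    have h1 : |(2 * m + 1 : ℝ)| = 2 * m + 1 := abs_of_nonneg (by positivity)
    simp only [norm_mul, norm_pow, norm_neg, norm_one, one_pow, one_mul, Real.norm_eq_abs, h1,
      Real.abs_exp, Nat.cast_zero, add_zero]
    gcongr
    have : (0 : ℝ) ≤ m := by positivity
    linarith
  have ho := (hasSum_ofReal.mpr hs).mul_left (2 * I)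
  have h := HasSum.even_add_odd (m := 0) (f := fun n : ℕ =>
    (n : ℂ) ^ k * (I * Real.exp (-(y * (π / 2)))) ^ n -
      (n : ℂ) ^ k * (-I * Real.exp (-(y * (π / 2)))) ^ n) (hasSum_zero.congr_fun (fun n => by
        rw [neg_mul, Even.neg_pow (even_two_mul n), sub_self]))
      (ho.congr_fun (fun n => by
        rw [neg_mul, Odd.neg_pow (odd_two_mul_add_one n), mul_pow, pow_succ I, pow_mul, I_sq,
          ← ofReal_pow, ← Real.exp_nat_mul]
        push_cast
        rw [show (2 * n + 1 : ℂ) * -(y * (π / 2)) = -((2 * n + 1) * (y * (π / 2))) by ring]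
        ring))
  rwa [zero_add] at h

open Complex in
lemma hasSum_alternating_inv_pow {k : ℕ} (hk : 1 ≤ k) {y : ℝ} (hy : 0 < y) :
    HasSum (fun m : ℤ => (-1) ^ m / (2 * m + 1 + I * y : ℂ) ^ (k + 1))
      (2 * I * (-(π * I / 2)) ^ (k + 1) / k.factorial * charSeries k y) := by
  let z₁ : UpperHalfPlane := ⟨(1 + I * y) / 4, by simpa using hy⟩
  let z₃ : UpperHalfPlane := ⟨(3 + I * y) / 4, by simpa using hy⟩
  have hz₁ : (z₁ : ℂ) = (1 + I * y) / 4 := rfl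
  have hz₃ : (z₃ : ℂ) = (3 + I * y) / 4 := rfl
  have e1 : cexp (2 * π * I * z₁) = I * Real.exp (-(y * (π / 2))) := by
    rw [hz₁, show 2 * π * I * ((1 + I * y) / 4) = π / 2 * I + (I * I) * (y * (π / 2)) by ring,
      Complex.exp_add, exp_pi_div_two_mul_I, I_mul_I]
    push_cast
    ring_nf
  have e3 : cexp (2 * π * I * z₃) = -I * Real.exp (-(y * (π / 2))) := by
    rw [hz₃, show 2 * π * I * ((3 + I * y) / 4) =
      π * I + (π / 2 * I + (I * I) * (y * (π / 2))) by ring,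
      Complex.exp_add, Complex.exp_add, exp_pi_mul_I, exp_pi_div_two_mul_I, I_mul_I]
    push_cast
    ring_nf
  have h1 := (hasSum_inv_pow_add_int hk z₁).mul_left (1 / 4 ^ (k + 1))
  have h3 := (hasSum_inv_pow_add_int hk z₃).mul_left (-(1 / 4 ^ (k + 1)))
  have s1 := summable_pow_mul_cexp k 1 z₁
  have s3 := summable_pow_mul_cexp k 1 z₃
  simp only [PNat.one_coe, Nat.cast_one, mul_one] at s1 s3
  rw [e1] at h1 s1
  rw [e3] at h3 s3
  have hU := (s1.hasSum.sub s3.hasSum).unique (hasSum_pow_mul_pow_sub_pow hy)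
  have key : ∀ z : ℂ, ∀ n : ℤ, 1 / (z / 4 + n) ^ (k + 1) = 4 ^ (k + 1) / (z + 4 * n) ^ (k + 1) := by
    intro z n
    rw [show z / 4 + n = (z + 4 * n) / 4 by ring, div_pow, one_div_div]
  have h := HasSum.int_even_add_odd' (f := fun m : ℤ => (-1) ^ m / (2 * m + 1 + I * y : ℂ) ^ (k + 1))
    (h1.congr_fun (fun n => by
      rw [hz₁, key, zpow_mul]
      push_cast
      rw [show (2 * (2 * n) + 1 + I * y : ℂ) = 1 + I * y + 4 * n by ring]
      field_simp
      simp))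
    (h3.congr_fun (fun n => by
      rw [hz₃, key, zpow_add_one₀ (by simp), zpow_mul]
      push_cast
      rw [show (2 * (2 * n + 1) + 1 + I * y : ℂ) = 3 + I * y + 4 * n by ring]
      field_simp
      simp))
  convert! h using 1
  rw [show -(π * I / 2) = (-2 * π * I) / 4 by ring, div_pow]
  linear_combination (-((-2 * π * I) ^ (k + 1) / 4 ^ (k + 1) / k.factorial)) * hU

lemma hasSum_lambert_charSeries (i k : ℕ) {t : ℝ} (ht : 0 < t) :
    HasSum (fun l : ℕ => (-1) ^ l * (2 * l + 1 : ℝ) ^ k * charSeries i ((2 * l + 1) * t))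
      (lambert 0 signOdd i k 1 0 (t * (π / 2))) := by
  have h := (summable_lambertTerm (e := 0) abs_signOdd_le i k 1 0
    (β := t * (π / 2)) (by positivity)).hasSum
  rw [← (Equiv.prodComm ℕ ℕ).hasSum_iff] at h
  have h2 := h.prod_fiberwise (fun l => (h.summable.prod_factor l).hasSum)
  refine h2.congr_fun (fun l => ?_)
  rw [charSeries, ← tsum_mul_left]
  congr 1
  funext m
  simp only [lambertTerm, signOdd, Function.comp, Equiv.prodComm_apply, Prod.fst_swap,
    Prod.snd_swap, Nat.cast_zero, add_zero, mul_zero, zero_add, Nat.cast_one, one_mul,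
    sin_pi_div_two, mul_one, pow_add]
  rw [show (2 * m + 1 : ℝ) * (2 * l + 1) * (t * (π / 2)) =
    (2 * m + 1) * ((2 * l + 1) * t * (π / 2)) by ring]
  ring

open Complex in
/-- The odd part of `1 / (x + i y) ^ 4` in `y`. -/
noncomputable def invPowFourOdd (x y : ℝ) : ℂ := 1 / (x + I * y : ℂ) ^ 4 - 1 / (x - I * y : ℂ) ^ 4

open Complex in
lemma invPowFourOdd_swap {t : ℝ} (ht : 0 < t) (x y : ℝ) :
    invPowFourOdd x (y * t) = -((1 / t ^ 4 : ℝ) : ℂ) * invPowFourOdd y (x * t⁻¹) := by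
  have ht' : (t : ℂ) ≠ 0 := ofReal_ne_zero.mpr ht.ne'
  have h1 : (x + I * (y * t : ℝ) : ℂ) ^ 4 = t ^ 4 * (y - I * (x * t⁻¹ : ℝ)) ^ 4 := by
    rw [show (x + I * (y * t : ℝ) : ℂ) = I * (t * (y - I * (x * t⁻¹ : ℝ))) by
      push_cast
      field_simp
      linear_combination (x : ℂ) * I_sq, mul_pow, I_pow_four, one_mul, mul_pow]
  have h2 : (x - I * (y * t : ℝ) : ℂ) ^ 4 = t ^ 4 * (y + I * (x * t⁻¹ : ℝ)) ^ 4 := by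
    rw [show (x - I * (y * t : ℝ) : ℂ) = -I * (t * (y + I * (x * t⁻¹ : ℝ))) by
      push_cast
      field_simp
      linear_combination (x : ℂ) * I_sq, mul_pow, neg_pow, I_pow_four, mul_pow]
    norm_num
  rw [invPowFourOdd, invPowFourOdd, h1, h2, ← one_div_mul_one_div, ← one_div_mul_one_div]
  push_cast
  ring

open Complex in
lemma norm_invPowFourOdd_le {x y : ℝ} (hx : 0 < x) (hy : 0 < y) :
    ‖invPowFourOdd x y‖ ≤ 1 / (2 * x ^ 2 * y ^ 2) := by
  have key : ∀ z : ℂ, normSq z = x ^ 2 + y ^ 2 → ‖1 / z ^ 4‖ ≤ 1 / (4 * x ^ 2 * y ^ 2) := by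
    intro z hz
    rw [norm_div, norm_one, norm_pow, show ‖z‖ ^ 4 = (‖z‖ ^ 2) ^ 2 by ring, ← normSq_eq_norm_sq, hz]
    apply one_div_le_one_div_of_le (by positivity)
    nlinarith [sq_nonneg (x ^ 2 - y ^ 2)]
  have h1 := key (x + I * y) (by rw [mul_comm, normSq_add_mul_I])
  have h2 := key (x - I * y) (by
    have := normSq_add_mul_I x (-y)
    push_cast at this
    rw [show (x - I * y : ℂ) = x + -y * I by ring, this]
    ring)
  calc _ ≤ _ := norm_sub_le _ _
    _ ≤ 1 / (4 * x ^ 2 * y ^ 2) + 1 / (4 * x ^ 2 * y ^ 2) := add_le_add h1 h2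
    _ = _ := by field_simp; norm_num

lemma summable_one_div_odd_sq : Summable fun m : ℕ => 1 / (2 * m + 1 : ℝ) ^ 2 := by
  have h := (summable_nat_add_iff 1).mpr (Real.summable_one_div_nat_pow.mpr one_lt_two)
  refine Summable.of_nonneg_of_le (fun m => by positivity) (fun m => ?_) h
  apply one_div_le_one_div_of_le (by positivity)
  push_cast
  gcongr
  have : (0 : ℝ) ≤ m := by positivity
  linarith

lemma summable_invPowFourOdd {t : ℝ} (ht : 0 < t) :
    Summable fun x : ℕ × ℕ => (-1 : ℂ) ^ (x.1 + x.2) *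
      invPowFourOdd (2 * x.1 + 1) ((2 * x.2 + 1) * t) := by
  refine Summable.of_norm_bounded
    ((summable_one_div_odd_sq.mul_of_nonneg summable_one_div_odd_sq
    (fun _ => by positivity) (fun _ => by positivity)).mul_left (1 / (2 * t ^ 2))) (fun x => ?_)
  rw [norm_mul, norm_pow, norm_neg, norm_one, one_pow, one_mul]
  refine (norm_invPowFourOdd_le (by positivity) (by positivity)).trans (le_of_eq ?_)
  field_simp

open Complex in
lemma hasSum_invPowFourOdd {y : ℝ} (hy : 0 < y) :
    HasSum (fun m : ℕ => (-1 : ℂ) ^ m * invPowFourOdd (2 * m + 1) y)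
      (I * π ^ 4 / 48 * charSeries 3 y) := by
  convert! (hasSum_alternating_inv_pow (k := 3) (by norm_num) hy).nat_add_neg_add_one using 1
  · funext m
    have h1 : (-(2 * m + 1) + I * y : ℂ) ^ 4 = (2 * m + 1 - I * y) ^ 4 := by ring
    rw [neg_one_zpow_neg_add_one, invPowFourOdd, zpow_natCast]
    push_cast
    rw [show (2 * (-(m + 1)) + 1 + I * y : ℂ) = -(2 * m + 1) + I * y by ring, h1]
    ring
  · rw [show (-(π * I / 2)) ^ (3 + 1) = (π / 2 : ℂ) ^ 4 * I ^ 4 by ring, I_pow_four,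
      show (Nat.factorial 3 : ℂ) = 6 by norm_num [Nat.factorial]]
    ring

open Complex in
lemma lambert_three_eq {t : ℝ} (ht : 0 < t) :
    I * π ^ 4 / 48 * lambert 0 signOdd 3 0 1 0 (t * (π / 2)) =
      ∑' x : ℕ × ℕ, (-1 : ℂ) ^ (x.1 + x.2) *
        invPowFourOdd (2 * x.1 + 1) ((2 * x.2 + 1) * t) := by
  have h := (summable_invPowFourOdd ht).hasSum
  rw [← (Equiv.prodComm ℕ ℕ).hasSum_iff] at h
  have h2 := h.prod_fiberwise (g := fun l : ℕ => I * π ^ 4 / 48 *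
    ((-1) ^ l * charSeries 3 ((2 * l + 1) * t))) (fun l => by
      have := (hasSum_invPowFourOdd (y := (2 * l + 1) * t) (by positivity)).mul_left ((-1) ^ l)
      convert! this using 1
      · funext m
        simp only [Function.comp, Equiv.prodComm_apply, Prod.fst_swap, Prod.snd_swap]
        ring
      · ring)
  have h3 := (hasSum_ofReal.mpr (hasSum_lambert_charSeries 3 0 ht)).mul_left (I * π ^ 4 / 48)
  refine (h3.congr_fun (fun l => ?_)).unique h2
  push_cast
  ring

lemma lambert_three_inv {t : ℝ} (ht : 0 < t) :
    t ^ 4 * lambert 0 signOdd 3 0 1 0 (t * (π / 2)) =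
      -lambert 0 signOdd 3 0 1 0 (t⁻¹ * (π / 2)) := by
  have h1 := lambert_three_eq ht
  have h2 := lambert_three_eq (inv_pos.mpr ht)
  have ht' : (t : ℂ) ≠ 0 := Complex.ofReal_ne_zero.mpr ht.ne'
  have h3 : ∑' x : ℕ × ℕ, (-1 : ℂ) ^ (x.1 + x.2) *
      invPowFourOdd (2 * x.1 + 1) ((2 * x.2 + 1) * t) = -((1 / t ^ 4 : ℝ) : ℂ) *
      ∑' x : ℕ × ℕ, (-1 : ℂ) ^ (x.1 + x.2) *
        invPowFourOdd (2 * x.1 + 1) ((2 * x.2 + 1) * t⁻¹) := by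
    rw [← tsum_mul_left, ← (Equiv.prodComm ℕ ℕ).tsum_eq]
    congr 1
    funext x
    simp only [Equiv.prodComm_apply, Prod.fst_swap, Prod.snd_swap]
    rw [invPowFourOdd_swap ht, add_comm x.2]
    ring
  rw [← h1, ← h2] at h3
  have hpi : (π : ℂ) ≠ 0 := Complex.ofReal_ne_zero.mpr pi_ne_zero
  have h4 : (t ^ 4 * lambert 0 signOdd 3 0 1 0 (t * (π / 2)) : ℂ) =
      -lambert 0 signOdd 3 0 1 0 (t⁻¹ * (π / 2)) := by
    have : Complex.I * π ^ 4 / 48 ≠ 0 := by simp [hpi]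
    apply mul_left_cancel₀ this
    push_cast at h3
    field_simp at h3 ⊢
    linear_combination h3
  exact_mod_cast h4

lemma oddSeries_three_inv {t : ℝ} (ht : 0 < t) :
    t ^ 4 * oddSeries 3 0 3 0 (t * (π / 2)) = -oddSeries 3 0 3 0 (t⁻¹ * (π / 2)) := by
  have h := lambert_three_inv ht
  rw [oddSeries_add_two, oddSeries_add_two, oddSeries, oddSeries]
  linear_combination -4 * h

lemma oddSeries_three_pi_div_two : oddSeries 3 0 3 0 (π / 2) = 0 := by
  have h := oddSeries_three_inv one_pos
  rw [inv_one, one_mul] at h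
  linarith

lemma evenSeries_one_pi_div_two (hp : oddSeries 1 0 1 0 (π / 2) ≠ 0) :
    evenSeries 1 0 1 0 (π / 2) = 1 / π := by
  have hpi := pi_pos
  have hπ : 0 < π / 2 := by positivity
  have hlin (t : ℝ) : HasDerivAt (fun t : ℝ => t * (π / 2)) (π / 2) t := by
    simpa using (hasDerivAt_id t).mul_const (π / 2)
  have hinv {t : ℝ} (ht : 0 < t) : HasDerivAt (fun t : ℝ => t⁻¹) (-(t ^ 2)⁻¹) t :=
    hasDerivAt_inv ht.ne'
  have d0 {t : ℝ} (ht : 0 < t) := (hasDerivAt_oddSeries_right 3 0 3 (β := t * (π / 2))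
    (by positivity) 0).comp t (hlin t)
  have d1 {t : ℝ} (ht : 0 < t) := (hasDerivAt_oddSeries_right 4 1 3 (β := t * (π / 2))
    (by positivity) 0).comp t (hlin t)
  have i0 {t : ℝ} (ht : 0 < t) := (d0 (inv_pos.mpr ht)).comp t (hinv ht)
  have i1 {t : ℝ} (ht : 0 < t) := (d1 (inv_pos.mpr ht)).comp t (hinv ht)
  have h1 (t : ℝ) (ht : 0 < t) : 4 * t ^ 3 * oddSeries 3 0 3 0 (t * (π / 2)) -
      t ^ 4 * (oddSeries 4 1 3 0 (t * (π / 2)) * (π / 2)) =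
      -(oddSeries 4 1 3 0 (t⁻¹ * (π / 2)) * (π / 2) * (t⁻¹) ^ 2) := by
    have h := deriv_eq_of_eq_of_pos (fun t ht => oddSeries_three_inv ht) ht
      (((hasDerivAt_id t).pow 4).mul (d0 ht)) (i0 ht).fun_neg
    norm_num at h
    rw [inv_pow]
    linear_combination h
  have h := deriv_eq_of_eq_of_pos h1 one_pos
    (((((hasDerivAt_id (1 : ℝ)).pow 3).const_mul 4).mul (d0 one_pos)).sub
      (((hasDerivAt_id (1 : ℝ)).pow 4).mul ((d1 one_pos).mul_const (π / 2))))
    (((i1 one_pos).mul_const (π / 2)).mul ((hinv one_pos).pow 2)).fun_neg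
  norm_num at h
  rw [oddSeries_three_pi_div_two, oddSeries_four_one_of_eq_zero hπ hp oddSeries_three_pi_div_two,
    oddSeries_five_two_of_eq_zero hπ hp oddSeries_three_pi_div_two] at h
  have h5 : oddSeries 1 0 1 0 (π / 2) ^ 3 * (π * 20) *
      (π * evenSeries 1 0 1 0 (π / 2) - 1) = 0 := by
    linear_combination h
  have h6 := (mul_eq_zero.mp h5).resolve_left (by positivity)
  field_simp
  linarith

lemma abs_cos_odd_mul_le (u : ℝ) (m : ℕ) : |cos ((2 * m + 1) * u)| ≤ (2 * m + 1) * |cos u| := by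
  induction m with
  | zero => simp
  | succ m ih =>
    have h1 : cos ((2 * (m + 1 : ℕ) + 1) * u) =
        cos ((2 * m + 1) * u) * cos (2 * u) - sin ((2 * m + 1) * u) * (2 * sin u * cos u) := by
      rw [← sin_two_mul, ← cos_add]
      congr 1
      push_cast
      ring
    have h2 : |cos ((2 * m + 1) * u) * cos (2 * u)| ≤ |cos ((2 * m + 1) * u)| := by
      rw [abs_mul]
      exact mul_le_of_le_one_right (abs_nonneg _) (abs_cos_le_one _)
    have h3 : |sin ((2 * m + 1) * u) * (2 * sin u * cos u)| ≤ 2 * |cos u| := by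
      rw [abs_mul, abs_mul, abs_mul, abs_two]
      have a := abs_sin_le_one u
      have b := abs_sin_le_one ((2 * m + 1) * u)
      calc _ ≤ 1 * (2 * 1 * |cos u|) := by gcongr
        _ = _ := by ring
    rw [h1]
    refine (abs_sub _ _).trans ?_
    push_cast
    linarith

lemma exp_neg_pi_le : exp (-π) ≤ 1 / 16 := by
  rw [exp_neg, ← one_div]
  apply one_div_le_one_div_of_le (by norm_num)
  have h1 : (16 : ℝ) ≤ exp 1 ^ 3 := by
    have := exp_one_gt_d9
    calc (16 : ℝ) ≤ 2.7 ^ 3 := by norm_num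
      _ ≤ _ := by gcongr; linarith
  refine h1.trans ?_
  rw [← exp_nat_mul]
  exact exp_le_exp.mpr (by push_cast; linarith [pi_gt_three])

lemma odd_sq_le (m : ℕ) : (2 * (m + 1 : ℕ) + 1 : ℝ) ^ 2 ≤ 9 * 3 ^ m := by
  induction m with
  | zero => norm_num
  | succ m ih =>
    push_cast at ih ⊢
    rw [pow_succ (3 : ℝ)]
    have : (0 : ℝ) ≤ m := by positivity
    nlinarith

lemma hasSum_oddSeries_cos (u : ℝ) :
    HasSum (fun m : ℕ => (-1) ^ m * (1 / (2 * cosh ((2 * m + 1) * (π / 2)))) * (2 * m + 1) *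
      cos ((2 * m + 1) * u)) (lambert 0 signOdd 1 0 1 u (π / 2)) := by
  have hβ : 0 < π / 2 := by positivity
  have h := hasSum_lambert_inner (e := 0) abs_signOdd_le (i := 1) (k := 0) (j := 1) (u := u) hβ
    (c := fun m => (-1) ^ m * (1 / (2 * cosh ((2 * m + 1) * (π / 2)))))
    (fun m => by simpa using hasSum_signOdd hβ m)
  simpa [sin_add_pi_div_two] using h

lemma oddSeries_one_pos {u : ℝ} (hu : 0 < cos u) : 0 < oddSeries 1 0 1 u (π / 2) := by
  set r := exp (-π) with hr
  have hr0 : 0 < r := exp_pos _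
  have hr1 : r ≤ 1 / 16 := exp_neg_pi_le
  set c := exp (-(π / 2)) with hc
  have hc0 : 0 < c := exp_pos _
  have hrc : r = c ^ 2 := by rw [hr, hc, ← exp_nat_mul]; congr 1; push_cast; ring
  have h := hasSum_oddSeries_cos u
  have h0 := (hasSum_nat_add_iff' 1).mpr h
  have hbd (m : ℕ) : ‖(-1) ^ (m + 1) * (1 / (2 * cosh ((2 * (m + 1 : ℕ) + 1) * (π / 2)))) *
      (2 * (m + 1 : ℕ) + 1) * cos ((2 * (m + 1 : ℕ) + 1) * u)‖ ≤
      9 * r * c * cos u * (3 * r) ^ m := by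
    have a1 := abs_cos_odd_mul_le u (m + 1)
    rw [abs_of_pos hu] at a1
    have a2 : 1 / (2 * cosh ((2 * (m + 1 : ℕ) + 1) * (π / 2))) ≤ r * r ^ m * c := by
      rw [cosh_eq, show r * r ^ m * c = exp (-((2 * (m + 1 : ℕ) + 1) * (π / 2))) by
        rw [hr, hc, ← exp_nat_mul, ← exp_add, ← exp_add]; congr 1; push_cast; ring, exp_neg,
        ← one_div]
      apply one_div_le_one_div_of_le (exp_pos _)
      have := one_div_pos.mpr (exp_pos ((2 * (m + 1 : ℕ) + 1) * (π / 2)))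
      linarith
    have hN : (0 : ℝ) < 2 * (m + 1 : ℕ) + 1 := by positivity
    rw [norm_mul, norm_mul, norm_mul, norm_pow, norm_neg, norm_one, one_pow, one_mul,
      Real.norm_of_nonneg (by positivity), Real.norm_of_nonneg hN.le, Real.norm_eq_abs]
    calc _ ≤ r * r ^ m * c * (2 * (m + 1 : ℕ) + 1) * ((2 * (m + 1 : ℕ) + 1) * cos u) := by gcongr
      _ = r * r ^ m * c * cos u * (2 * (m + 1 : ℕ) + 1) ^ 2 := by ring
      _ ≤ r * r ^ m * c * cos u * (9 * 3 ^ m) := by gcongr; exact odd_sq_le m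
      _ = _ := by rw [mul_pow]; ring
  have hgeo := (hasSum_geometric_of_lt_one (r := 3 * r) (by positivity) (by linarith)).mul_left
    (9 * r * c * cos u)
  have hle := h0.norm_le_of_bounded hgeo hbd
  rw [Finset.sum_range_one, Real.norm_eq_abs, abs_le] at hle
  have hz : (-1) ^ 0 * (1 / (2 * cosh ((2 * (0 : ℕ) + 1) * (π / 2)))) * (2 * (0 : ℕ) + 1) *
      cos ((2 * (0 : ℕ) + 1) * u) = c * cos u / (1 + r) := by
    have : exp (π / 2) = c⁻¹ := by rw [hc, exp_neg, inv_inv]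
    norm_num
    rw [cosh_eq, this, hrc, ← hc]
    field_simp
  rw [hz] at hle
  have h3 : 9 * r * c * cos u * (1 - 3 * r)⁻¹ ≤ c * cos u * (9 / 13) := by
    rw [← div_eq_mul_inv, div_le_iff₀ (by linarith)]
    have : 0 < c * cos u := by positivity
    nlinarith
  have h4 : c * cos u * (16 / 17) ≤ c * cos u / (1 + r) := by
    rw [le_div_iff₀ (by linarith)]
    have : 0 < c * cos u := by positivity
    nlinarith
  have : 0 < c * cos u := by positivity
  rw [oddSeries]
  linarith [hle.1]

lemma oddSeries_one_apply_pi_div_two : oddSeries 1 0 1 (π / 2) (π / 2) = 0 := by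
  have h := hasSum_oddSeries_cos (π / 2)
  have h0 (m : ℕ) : cos ((2 * m + 1) * (π / 2)) = 0 := by
    rw [cos_eq_zero_iff]
    exact ⟨m, by push_cast; ring⟩
  simp only [h0, mul_zero] at h
  rw [oddSeries, h.unique hasSum_zero, mul_zero]

lemma oddSeries_zero_strictMonoOn :
    StrictMonoOn (fun u => oddSeries 0 0 0 u (π / 2)) (Set.Icc 0 (π / 2)) := by
  have hd := fun u => hasDerivAt_oddSeries_left 0 0 0 (β := π / 2) (by positivity) u
  refine strictMonoOn_of_deriv_pos (convex_Icc _ _)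
    (fun u _ => (hd u).continuousAt.continuousWithinAt) (fun u hu => ?_)
  rw [interior_Icc] at hu
  rw [(hd u).deriv]
  exact oddSeries_one_pos (cos_pos_of_mem_Ioo ⟨by linarith [hu.1, pi_pos], hu.2⟩)

lemma oddSeries_zero_pos {u : ℝ} (hu : u ∈ Set.Ioc 0 (π / 2)) : 0 < oddSeries 0 0 0 u (π / 2) := by
  have h := oddSeries_zero_strictMonoOn (a := 0) (b := u)
    ⟨le_rfl, by positivity⟩ ⟨hu.1.le, hu.2⟩ hu.1
  simpa [oddSeries_apply_zero] using h

lemma exists_oddSeries_two_add : ∃ K : ℝ, ∀ u ∈ Set.Icc 0 (π / 2),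
    oddSeries 2 0 2 u (π / 2) + 2 * oddSeries 0 0 0 u (π / 2) ^ 3 =
      K * oddSeries 0 0 0 u (π / 2) := by
  have hβ : 0 < π / 2 := by positivity
  have d0 := hasDerivAt_oddSeries_left 0 0 0 hβ
  have d2 := hasDerivAt_oddSeries_left 2 0 2 hβ
  have dh {u : ℝ} (hu : u ∈ Set.Ioc 0 (π / 2)) : HasDerivAt (fun u =>
      (oddSeries 2 0 2 u (π / 2) + 2 * oddSeries 0 0 0 u (π / 2) ^ 3) /
        oddSeries 0 0 0 u (π / 2)) 0 u := by
    convert! ((d2 u).add (((d0 u).pow 3).const_mul 2)).div (d0 u) (oddSeries_zero_pos hu).ne'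
      using 1
    have hc := oddSeries_cubic hβ u
    have := (oddSeries_zero_pos hu).ne'
    norm_num
    field_simp
    linear_combination -hc
  refine ⟨(oddSeries 2 0 2 (π / 2) (π / 2) + 2 * oddSeries 0 0 0 (π / 2) (π / 2) ^ 3) /
        oddSeries 0 0 0 (π / 2) (π / 2), fun u hu => ?_⟩
  rcases hu.1.eq_or_lt with rfl | h0
  · simp [oddSeries_add_two, oddSeries_apply_zero]
  · have h := constant_of_has_deriv_right_zero (a := u) (b := π / 2)
      (fun v hv => (dh ⟨h0.trans_le hv.1, hv.2⟩).continuousAt.continuousWithinAt)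
      (fun v hv => (dh ⟨h0.trans_le hv.1, hv.2.le⟩).hasDerivWithinAt) (π / 2) ⟨hu.2, le_rfl⟩
    rw [h, div_mul_cancel₀ _ (oddSeries_zero_pos ⟨h0, hu.2⟩).ne']

lemma oddSeries_two_eq {u : ℝ} (hu : u ∈ Set.Icc 0 (π / 2)) :
    oddSeries 2 0 2 u (π / 2) = -2 * oddSeries 0 0 0 u (π / 2) ^ 3 := by
  obtain ⟨K, hK⟩ := exists_oddSeries_two_add
  have hβ : 0 < π / 2 := by positivity
  have d0 := (hasDerivAt_oddSeries_left 0 0 0 hβ 0).hasDerivWithinAt (s := Set.Icc 0 (π / 2))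
  have d2 := (hasDerivAt_oddSeries_left 2 0 2 hβ 0).hasDerivWithinAt (s := Set.Icc 0 (π / 2))
  have h1 := d2.add ((d0.pow 3).const_mul 2)
  have h0 : (0 : ℝ) ∈ Set.Icc 0 (π / 2) := ⟨le_rfl, hβ.le⟩
  have h2 := (d0.const_mul K).congr hK (hK 0 h0)
  have h3 := (uniqueDiffOn_Icc hβ 0 h0).eq_deriv _ h1 h2
  have hK0 : K = 0 := by
    norm_num [oddSeries_apply_zero, oddSeries_three_pi_div_two] at h3
    exact h3.resolve_right (oddSeries_one_pos (by simp)).ne'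
  have := hK u hu
  rw [hK0] at this
  linarith

lemma oddSeries_one_sq {u : ℝ} (hu : u ∈ Set.Icc 0 (π / 2)) :
    oddSeries 1 0 1 u (π / 2) ^ 2 =
      oddSeries 1 0 1 0 (π / 2) ^ 2 - oddSeries 0 0 0 u (π / 2) ^ 4 := by
  have h := oddSeries_quadratic (by positivity : 0 < π / 2) u
  rw [oddSeries_two_eq hu] at h
  linarith

lemma oddSeries_zero_sq : oddSeries 0 0 0 (π / 2) (π / 2) ^ 2 = oddSeries 1 0 1 0 (π / 2) := by
  have hm : π / 2 ∈ Set.Icc 0 (π / 2) := ⟨by positivity, le_rfl⟩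
  have h := oddSeries_one_sq hm
  rw [oddSeries_one_apply_pi_div_two] at h
  have hp := oddSeries_one_pos (u := 0) (by simp)
  have : (oddSeries 0 0 0 (π / 2) (π / 2) ^ 2) ^ 2 = oddSeries 1 0 1 0 (π / 2) ^ 2 := by
    linarith
  exact (pow_left_inj₀ (by positivity) hp.le two_ne_zero).mp this

lemma image_oddSeries_zero : (fun u => (oddSeries 0 0 0 u (π / 2) /
    oddSeries 0 0 0 (π / 2) (π / 2)) ^ 4) '' Set.Ioo 0 (π / 2) = Set.Ioo 0 1 := by
  have hβ : 0 < π / 2 := by positivity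
  have hM := oddSeries_zero_pos (u := π / 2) ⟨hβ, le_rfl⟩
  have hmono := oddSeries_zero_strictMonoOn
  have d0 := hasDerivAt_oddSeries_left 0 0 0 hβ
  apply Set.Subset.antisymm
  · rintro _ ⟨u, hu, rfl⟩
    have h1 := oddSeries_zero_pos ⟨hu.1, hu.2.le⟩
    have h2 := hmono ⟨hu.1.le, hu.2.le⟩ ⟨hβ.le, le_rfl⟩ hu.2
    exact ⟨by positivity, pow_lt_one₀ (by positivity) ((div_lt_one hM).mpr h2) (by norm_num)⟩
  · have h := intermediate_value_Ioo hβ.le (f := fun u => (oddSeries 0 0 0 u (π / 2) /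
      oddSeries 0 0 0 (π / 2) (π / 2)) ^ 4)
      (fun u _ => (((d0 u).div_const _).pow 4).continuousAt.continuousWithinAt)
    simpa [oddSeries_apply_zero, hM.ne'] using h

open Complex in
lemma betaIntegral_eq_oddSeries :
    betaIntegral (1 / 4 : ℝ) (1 / 2 : ℝ) = (2 * π * oddSeries 0 0 0 (π / 2) (π / 2) : ℝ) := by
  have hβ : 0 < π / 2 := by positivity
  set M := oddSeries 0 0 0 (π / 2) (π / 2) with hMdef
  have hM : 0 < M := oddSeries_zero_pos (u := π / 2) ⟨hβ, le_rfl⟩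
  have hmono := oddSeries_zero_strictMonoOn
  have d0 := hasDerivAt_oddSeries_left 0 0 0 hβ
  rw [betaIntegral, intervalIntegral.integral_of_le zero_le_one,
    MeasureTheory.integral_Ioc_eq_integral_Ioo, ← image_oddSeries_zero,
    MeasureTheory.integral_image_eq_integral_abs_deriv_smul measurableSet_Ioo
      (fun u _ => (((d0 u).div_const M).fun_pow 4).hasDerivWithinAt) (fun u hu v hv huv => by
        have h1 := oddSeries_zero_pos ⟨hu.1, hu.2.le⟩
        have h2 := oddSeries_zero_pos ⟨hv.1, hv.2.le⟩
        have h3 := (pow_left_inj₀ (by positivity) (by positivity) (by norm_num)).mp huv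
        exact hmono.injOn ⟨hu.1.le, hu.2.le⟩ ⟨hv.1.le, hv.2.le⟩
          ((div_left_inj' hM.ne').mp h3))]
  rw [MeasureTheory.setIntegral_congr_fun (g := fun _ => ((4 * M : ℝ) : ℂ)) measurableSet_Ioo]
  · simp [max_eq_left hβ.le]
    ring
  · intro u hu
    have g0 := oddSeries_zero_pos ⟨hu.1, hu.2.le⟩
    have g1 := oddSeries_one_pos (Real.cos_pos_of_mem_Ioo ⟨by linarith [hu.1, Real.pi_pos], hu.2⟩)
    have hsq := oddSeries_one_sq ⟨hu.1.le, hu.2.le⟩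
    rw [← oddSeries_zero_sq, ← hMdef] at hsq
    simp only [zero_add]
    set x := oddSeries 0 0 0 u (π / 2)
    set y := oddSeries 1 0 1 u (π / 2)
    have hx : (((x / M) ^ 4 : ℝ) : ℂ) ^ (((1 / 4 : ℝ) : ℂ) - 1) = ((M / x) ^ 3 : ℝ) := by
      rw [show ((1 / 4 : ℝ) : ℂ) - 1 = ((-(3 / 4) : ℝ) : ℂ) by push_cast; ring,
        ← ofReal_cpow (by positivity)]
      congr 1
      rw [← Real.rpow_natCast, ← Real.rpow_mul (by positivity), ← inv_div, ← Real.rpow_natCast,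
        Real.inv_rpow (by positivity), ← Real.rpow_neg (by positivity)]
      norm_num
    have hy : (1 - ((x / M) ^ 4 : ℝ) : ℂ) ^ (((1 / 2 : ℝ) : ℂ) - 1) = (M ^ 2 / y : ℝ) := by
      have h1 : 1 - (x / M) ^ 4 = (y / M ^ 2) ^ 2 := by
        field_simp
        linarith
      rw [show (1 - ((x / M) ^ 4 : ℝ) : ℂ) = ((1 - (x / M) ^ 4 : ℝ) : ℂ) by push_cast; ring, h1,
        show ((1 / 2 : ℝ) : ℂ) - 1 = ((-(1 / 2) : ℝ) : ℂ) by push_cast; ring,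
        ← ofReal_cpow (by positivity)]
      congr 1
      rw [← Real.rpow_natCast, ← Real.rpow_mul (by positivity), ← inv_div (y : ℝ)]
      norm_num [Real.rpow_neg_one]
    rw [hx, hy, abs_of_pos (by positivity), real_smul, ← ofReal_mul, ← ofReal_mul]
    congr 1
    norm_num
    field_simp

lemma Gamma_one_fourth_pow_four :
    Gamma (1 / 4) ^ 4 = 8 * π ^ 3 * oddSeries 1 0 1 0 (π / 2) := by
  have h1 : Gamma (1 / 4) * Gamma (1 / 2) =
      Gamma (3 / 4) * (2 * π * oddSeries 0 0 0 (π / 2) (π / 2)) := by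
    have h := Complex.Gamma_mul_Gamma_eq_betaIntegral (s := (1 / 4 : ℝ)) (t := (1 / 2 : ℝ))
      (by rw [Complex.ofReal_re]; norm_num) (by rw [Complex.ofReal_re]; norm_num)
    rw [betaIntegral_eq_oddSeries, ← Complex.ofReal_add, Complex.Gamma_ofReal, Complex.Gamma_ofReal,
      Complex.Gamma_ofReal, show (1 / 4 + 1 / 2 : ℝ) = 3 / 4 by norm_num] at h
    exact_mod_cast h
  have h2 := Gamma_mul_Gamma_one_sub (1 / 4)
  rw [show π * (1 / 4) = π / 4 by ring, sin_pi_div_four,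
    show (1 - 1 / 4 : ℝ) = 3 / 4 by norm_num] at h2
  rw [Gamma_one_half_eq] at h1
  have hG : 0 < Gamma (3 / 4) := Gamma_pos_of_pos (by norm_num)
  have hG' : 0 < Gamma (1 / 4) := Gamma_pos_of_pos (by norm_num)
  rw [← oddSeries_zero_sq]
  set M := oddSeries 0 0 0 (π / 2) (π / 2)
  have h3 : (Gamma (1 / 4) * Gamma (3 / 4)) ^ 2 = 2 * π ^ 2 := by
    rw [h2, div_pow, div_pow, sq_sqrt (by norm_num)]
    field_simp
  have h4 : (Gamma (1 / 4) * √π) ^ 2 = (Gamma (3 / 4) * (2 * π * M)) ^ 2 := by rw [h1]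
  rw [mul_pow, sq_sqrt pi_pos.le] at h4
  have h5 : π * Gamma (1 / 4) ^ 4 = π * (8 * π ^ 3 * M ^ 2) := by
    linear_combination Gamma (1 / 4) ^ 2 * h4 + 4 * π ^ 2 * M ^ 2 * h3
  exact mul_left_cancel₀ pi_ne_zero h5

lemma integrableOn_pow_mul_exp_neg_mul (k : ℕ) {c : ℝ} (hc : 0 < c) :
    MeasureTheory.IntegrableOn (fun x : ℝ => x ^ k * exp (-(c * x))) (Set.Ioi 0) := by
  have h := integrableOn_rpow_mul_exp_neg_mul_rpow (s := k) (p := 1) (b := c)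
    (by linarith [k.cast_nonneg (α := ℝ)]) one_pos hc
  simpa using h

section ComplexLaplace
open Complex

lemma norm_ofReal_pow_mul_cexp (k : ℕ) (w : ℂ) {x : ℝ} (hx : 0 ≤ x) :
    ‖(x : ℂ) ^ k * cexp (-(w * x))‖ = x ^ k * Real.exp (-(w.re * x)) := by
  rw [norm_mul, norm_pow, norm_exp, norm_real, Real.norm_of_nonneg hx]
  simp

lemma integrableOn_pow_mul_cexp_neg_mul (k : ℕ) {w : ℂ} (hw : 0 < w.re) :
    MeasureTheory.IntegrableOn (fun x : ℝ => (x : ℂ) ^ k * cexp (-(w * x))) (Set.Ioi 0) := by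
  refine (integrableOn_pow_mul_exp_neg_mul k hw).mono'
    (Continuous.aestronglyMeasurable (by fun_prop)) ?_
  filter_upwards [MeasureTheory.ae_restrict_mem measurableSet_Ioi] with x hx
  exact (norm_ofReal_pow_mul_cexp k w hx.le).le

lemma integral_pow_mul_cexp_neg_mul (k : ℕ) {w : ℂ} (hw : 0 < w.re) :
    ∫ x : ℝ in Set.Ioi 0, (x : ℂ) ^ k * cexp (-(w * x)) = k.factorial / w ^ (k + 1) := by
  have hw0 : w ≠ 0 := fun h => by simp [h] at hw
  have ht (k : ℕ) : Filter.Tendsto (fun x : ℝ => (x : ℂ) ^ k * cexp (-(w * x))) Filter.atTop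
      (nhds 0) := by
    rw [tendsto_zero_iff_norm_tendsto_zero]
    refine (tendsto_rpow_mul_exp_neg_mul_atTop_nhds_zero k w.re hw).congr' ?_
    filter_upwards [Filter.eventually_ge_atTop 0] with x hx
    rw [norm_ofReal_pow_mul_cexp k w hx, Real.rpow_natCast, neg_mul]
  have he (x : ℝ) : HasDerivAt (fun x : ℝ => cexp (-(w * x))) (cexp (-(w * x)) * -w) x := by
    have := ((ofRealCLM.hasDerivAt (x := x)).const_mul w).neg.cexp
    simpa using this
  induction k with
  | zero =>
    have h := MeasureTheory.integral_Ioi_of_hasDerivAt_of_tendsto' (a := 0)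
      (fun x _ => (he x).const_mul (-w⁻¹))
      (by simpa [mul_comm, hw0] using integrableOn_pow_mul_cexp_neg_mul 0 hw)
      ((by simpa using ht 0 : Filter.Tendsto (fun x : ℝ => cexp (-(w * x))) Filter.atTop
        (nhds 0)).const_mul (-w⁻¹))
    have h2 (x : ℝ) : -w⁻¹ * (cexp (-(w * x)) * -w) = (x : ℂ) ^ 0 * cexp (-(w * x)) := by
      field_simp
    simp_rw [h2] at h
    rw [h]
    simp
  | succ k ih =>
    have hd (x : ℝ) : HasDerivAt (fun x : ℝ => (x : ℂ) ^ (k + 1) * cexp (-(w * x)))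
        ((k + 1) * ((x : ℂ) ^ k * cexp (-(w * x))) -
          w * ((x : ℂ) ^ (k + 1) * cexp (-(w * x)))) x := by
      convert! ((ofRealCLM.hasDerivAt (x := x)).fun_pow (k + 1)).mul (he x) using 1
      simp
      ring
    have i0 := (integrableOn_pow_mul_cexp_neg_mul k hw).const_mul (k + 1 : ℂ)
    have i1 := (integrableOn_pow_mul_cexp_neg_mul (k + 1) hw).const_mul w
    have h := MeasureTheory.integral_Ioi_of_hasDerivAt_of_tendsto' (a := 0)
      (fun x _ => hd x) (i0.sub i1) (ht (k + 1))
    rw [MeasureTheory.integral_sub i0 i1, MeasureTheory.integral_const_mul,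
      MeasureTheory.integral_const_mul, ih] at h
    simp only [ofReal_zero, ne_eq, Nat.add_eq_zero_iff, one_ne_zero, and_false, not_false_eq_true,
      zero_pow, zero_mul, sub_zero] at h
    rw [eq_div_iff (pow_ne_zero _ hw0), Nat.factorial_succ]
    field_simp at h
    push_cast
    rw [pow_succ w (k + 1)]
    linear_combination -h

/-- The function `(2 z / (1 + z ^ 2)) ^ 3`, with `z = exp (-w)` it is `(sech w) ^ 3`. -/
noncomputable def sechCube (z : ℂ) : ℂ := 8 * z ^ 3 / (1 + z ^ 2) ^ 3

/-- The coefficients of `sechCube`. -/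
noncomputable def sechCubeCoeff (l : ℕ) : ℝ := -(-1) ^ l * ((2 * l + 1) ^ 2 - 1)

lemma abs_sechCubeCoeff_le (l : ℕ) : |sechCubeCoeff l| ≤ (2 * l + 1 : ℝ) ^ 2 := by
  have h : (1 : ℝ) ≤ (2 * l + 1) ^ 2 := by
    have : (0 : ℝ) ≤ l := by positivity
    nlinarith
  rw [sechCubeCoeff, abs_mul, abs_neg, abs_pow, abs_neg, abs_one, one_pow, one_mul,
    abs_of_nonneg (by linarith)]
  linarith

lemma hasSum_sechCube {z : ℂ} (hz : ‖z‖ < 1) :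
    HasSum (fun l : ℕ => (sechCubeCoeff l : ℂ) * z ^ (2 * l + 1)) (sechCube z) := by
  have hr : ‖-z ^ 2‖ < 1 := by
    rw [norm_neg, norm_pow]
    exact pow_lt_one₀ (norm_nonneg _) hz two_ne_zero
  have h := (hasSum_choose_mul_geometric_of_norm_lt_one 2 hr).mul_left (8 * z ^ 3)
  rw [← hasSum_nat_add_iff' 1, Finset.sum_range_one]
  convert! h using 1
  · funext l
    have hc : (((l + 2).choose 2 : ℕ) : ℂ) = (l + 2) * (l + 1) / 2 := by
      rw [Nat.cast_choose_two]
      push_cast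
      ring
    rw [hc, sechCubeCoeff, neg_pow (z ^ 2), ← pow_mul]
    push_cast
    ring
  · simp [sechCube, sechCubeCoeff]
    ring

lemma hasSum_integral_sechCube {g : ℝ → ℂ} {w : ℂ} (hw : w.re = 1 / 2) (hg : Measurable g)
    (hb : ∀ x, 0 < x → ‖g x‖ ≤ 1) :
    HasSum (fun l : ℕ => (sechCubeCoeff l : ℂ) *
      ∫ x : ℝ in Set.Ioi 0, x ^ 5 * g x * cexp (-((2 * l + 1) * w * x)))
      (∫ x : ℝ in Set.Ioi 0, x ^ 5 * g x * sechCube (cexp (-(w * x)))) := by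
  have hbound (l : ℕ) (x : ℝ) (hx : 0 < x) :
      ‖(sechCubeCoeff l : ℂ) * (x ^ 5 * g x * cexp (-((2 * l + 1) * w * x)))‖ ≤
      (2 * l + 1) ^ 2 * (x ^ 5 * Real.exp (-((2 * l + 1) / 2 * x))) := by
    have h1 : ‖cexp (-((2 * l + 1) * w * x))‖ = Real.exp (-((2 * l + 1) / 2 * x)) := by
      rw [norm_exp, show (2 * l + 1 : ℂ) = ((2 * l + 1 : ℝ) : ℂ) by push_cast; ring, neg_re,
        re_mul_ofReal, re_ofReal_mul, hw]
      congr 1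
      ring
    rw [norm_mul, norm_mul, norm_mul, h1, norm_pow, norm_real, norm_real,
      Real.norm_of_nonneg hx.le, Real.norm_eq_abs]
    have := hb x hx
    calc _ ≤ (2 * l + 1) ^ 2 * (x ^ 5 * 1 * Real.exp (-((2 * l + 1) / 2 * x))) := by
          gcongr
          exact abs_sechCubeCoeff_le l
      _ = _ := by rw [mul_one]
  have hpos (l : ℕ) : 0 < (2 * l + 1 : ℝ) / 2 := by positivity
  have hmeas (l : ℕ) : Measurable fun x : ℝ =>
      (sechCubeCoeff l : ℂ) * (x ^ 5 * g x * cexp (-((2 * l + 1) * w * x))) := by fun_prop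
  have h_integrable (l : ℕ) : MeasureTheory.IntegrableOn (fun x : ℝ =>
      (sechCubeCoeff l : ℂ) * (x ^ 5 * g x * cexp (-((2 * l + 1) * w * x)))) (Set.Ioi 0) := by
    refine ((integrableOn_pow_mul_exp_neg_mul 5 (hpos l)).const_mul ((2 * l + 1) ^ 2)).mono'
      (hmeas l).aestronglyMeasurable ?_
    filter_upwards [MeasureTheory.ae_restrict_mem measurableSet_Ioi] with x hx
    exact hbound l x hx
  have hval (l : ℕ) : ∫ x : ℝ in Set.Ioi 0, x ^ 5 * Real.exp (-((2 * l + 1) / 2 * x)) =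
      120 / ((2 * l + 1) / 2) ^ 6 := by
    have h := integral_pow_mul_cexp_neg_mul 5 (w := ((2 * l + 1) / 2 : ℝ)) (by
      rw [ofReal_re]; exact hpos l)
    have h2 : ∀ x : ℝ, (x : ℂ) ^ 5 * cexp (-(((2 * l + 1) / 2 : ℝ) * x)) =
        ((x ^ 5 * Real.exp (-((2 * l + 1) / 2 * x)) : ℝ) : ℂ) := fun x => by push_cast; rfl
    simp_rw [h2] at h
    rw [integral_complex_ofReal, show ((5 : ℕ).factorial : ℂ) = (120 : ℝ) by norm_num [Nat.factorial],
      ← ofReal_pow, ← ofReal_div] at h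
    exact_mod_cast h
  have hsum : Summable fun l : ℕ => ∫ x : ℝ in Set.Ioi 0,
      ‖(sechCubeCoeff l : ℂ) * (x ^ 5 * g x * cexp (-((2 * l + 1) * w * x)))‖ := by
    refine Summable.of_nonneg_of_le (fun l => MeasureTheory.integral_nonneg fun _ => norm_nonneg _)
      (fun l => ?_) (summable_one_div_odd_sq.mul_left 7680)
    calc _ ≤ ∫ x : ℝ in Set.Ioi 0,
          (2 * l + 1) ^ 2 * (x ^ 5 * Real.exp (-((2 * l + 1) / 2 * x))) :=
          MeasureTheory.setIntegral_mono_on (h_integrable l).norm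
            ((integrableOn_pow_mul_exp_neg_mul 5 (hpos l)).const_mul _) measurableSet_Ioi
            (fun x hx => hbound l x hx)
      _ = 7680 * (1 / (2 * l + 1) ^ 4) := by
          rw [MeasureTheory.integral_const_mul, hval]
          field_simp
          norm_num
      _ ≤ _ := by
          gcongr
          · linarith [l.cast_nonneg (α := ℝ)]
          · norm_num
  have h := MeasureTheory.hasSum_integral_of_summable_integral_norm h_integrable hsum
  convert! h using 1
  · funext l
    rw [MeasureTheory.integral_const_mul]
  · refine MeasureTheory.setIntegral_congr_fun measurableSet_Ioi (fun x hx => ?_)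
    have hx : 0 < x := hx
    have hz : ‖cexp (-(w * x))‖ < 1 := by
      rw [norm_exp, neg_re, re_mul_ofReal, hw, Real.exp_lt_one_iff]
      linarith
    rw [← ((hasSum_sechCube hz).mul_left (x ^ 5 * g x : ℂ)).tsum_eq]
    congr 1
    funext l
    rw [← Complex.exp_nat_mul]
    rw [show ((2 * l + 1 : ℕ) : ℂ) * -(w * x) = -((2 * l + 1) * w * x) by push_cast; ring]
    ring

end ComplexLaplace

section ComplexIntegral
open Complex

lemma sechCube_mul_sechCube (x : ℝ) :
    sechCube (cexp (-((1 + I) / 2 * x))) * sechCube (cexp (-((1 - I) / 2 * x))) =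
      (8 / (Real.cos x + Real.cosh x) ^ 3 : ℝ) := by
  set z := cexp (-((1 + I) / 2 * x)) with hz
  set z' := cexp (-((1 - I) / 2 * x)) with hz'
  have h1 : z * z' = cexp (-x) := by
    rw [hz, hz', ← Complex.exp_add]
    congr 1
    ring
  have h2 : (1 + z ^ 2) * (1 + z' ^ 2) = 2 * (z * z') * (Complex.cos x + Complex.cosh x) := by
    have a1 : z ^ 2 = cexp (-x) * cexp (-x * I) := by
      rw [hz, ← Complex.exp_nat_mul, ← Complex.exp_add]
      congr 1
      push_cast
      ring
    have a2 : z' ^ 2 = cexp (-x) * cexp (x * I) := by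
      rw [hz', ← Complex.exp_nat_mul, ← Complex.exp_add]
      congr 1
      push_cast
      ring
    have a3 : cexp (-x) * cexp x = 1 := by rw [← Complex.exp_add, neg_add_cancel, Complex.exp_zero]
    have a4 : cexp (-x * I) * cexp (x * I) = 1 := by
      rw [← Complex.exp_add, neg_mul, neg_add_cancel, Complex.exp_zero]
    rw [h1, Complex.cos, Complex.cosh, a1, a2]
    linear_combination cexp (-x) ^ 2 * a4 - a3
  have h3 : z * z' ≠ 0 := by rw [h1]; exact Complex.exp_ne_zero _
  rw [sechCube, sechCube, div_mul_div_comm, ← mul_pow, h2, mul_pow, mul_pow]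
  push_cast
  rw [show 8 * z ^ 3 * (8 * z' ^ 3) = (z * z') ^ 3 * 64 by ring,
    show (2 : ℂ) ^ 3 * (z * z') ^ 3 * (Complex.cos x + Complex.cosh x) ^ 3 =
      (z * z') ^ 3 * (8 * (Complex.cos x + Complex.cosh x) ^ 3) by ring,
    mul_div_mul_left _ _ (pow_ne_zero _ h3), show (64 : ℂ) = 8 * 8 by norm_num,
    mul_div_mul_left _ _ (by norm_num)]

lemma two_le_cos_add_cosh (x : ℝ) : 2 ≤ Real.cos x + Real.cosh x := by
  have h1 := Real.one_sub_sq_div_two_le_cos (x := x)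
  have h2 : 1 + x ^ 2 / 2 ≤ Real.cosh x := by
    rw [← Real.cosh_abs, ← sq_abs, show |x| = 2 * (|x| / 2) by ring, Real.cosh_two_mul,
      Real.cosh_sq]
    have := Real.self_le_sinh_iff.mpr (by positivity : 0 ≤ |x| / 2)
    nlinarith [abs_nonneg x]
  linarith

lemma norm_sechCube_le (x : ℝ) : ‖sechCube (cexp (-((1 - I) / 2 * x)))‖ ≤ 1 := by
  have h1 : sechCube (cexp (-((1 + I) / 2 * x))) =
      (starRingEnd ℂ) (sechCube (cexp (-((1 - I) / 2 * x)))) := by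
    simp [sechCube, ← Complex.exp_conj, conj_ofNat]
  have h2 := sechCube_mul_sechCube x
  have h3 := two_le_cos_add_cosh x
  have h4 : 8 / (Real.cos x + Real.cosh x) ^ 3 ≤ 1 := by
    rw [div_le_one (by positivity)]
    calc (8 : ℝ) = 2 ^ 3 := by norm_num
      _ ≤ _ := by gcongr
  rw [h1, conj_mul', ← ofReal_pow, ofReal_inj] at h2
  rw [← h2] at h4
  exact (pow_le_one_iff_of_nonneg (norm_nonneg _) two_ne_zero).mp h4

lemma hasSum_alternating_quadratic_div {b : ℝ} (hb : 0 < b) :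
    HasSum (fun m : ℤ => (-1) ^ m * ((2 * m + 1) ^ 2 - 1) / (2 * m + 1 + I * b : ℂ) ^ 6)
      (I * ((π / 2) ^ 4 / 3 * charSeries 3 b - b * (π / 2) ^ 5 / 6 * charSeries 4 b +
        (b ^ 2 + 1) * (π / 2) ^ 6 / 60 * charSeries 5 b)) := by
  have h3 := hasSum_alternating_inv_pow (k := 3) (by norm_num) hb
  have h4 := (hasSum_alternating_inv_pow (k := 4) (by norm_num) hb).mul_left (2 * I * b)
  have h5 := (hasSum_alternating_inv_pow (k := 5) (by norm_num) hb).mul_left (b ^ 2 + 1 : ℂ)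
  convert! (h3.sub h4).sub h5 using 1
  · funext m
    have : (2 * m + 1 + I * b : ℂ) ≠ 0 := fun h => by
      have h1 := congrArg im h
      rw [show (2 * m + 1 + I * b : ℂ) = ((2 * m + 1 : ℝ) : ℂ) + b * I by push_cast; ring, add_im,
        ofReal_im, im_ofReal_mul, I_im, mul_one, zero_add, zero_im] at h1
      exact hb.ne' h1
    obtain ⟨w, hw⟩ : ∃ w : ℂ, w = 2 * m + 1 + I * b := ⟨_, rfl⟩
    rw [← hw] at this ⊢
    rw [show (2 * m + 1 : ℂ) = w - I * b by rw [hw]; ring]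
    generalize (-1 : ℂ) ^ m = s
    rw [show s / w ^ (3 + 1) = s * w ^ 2 / w ^ 6 by field_simp,
      show s / w ^ (4 + 1) = s * w / w ^ 6 by field_simp]
    linear_combination (s * (b : ℂ) ^ 2 / w ^ 6) * I_sq
  · rw [show (-(π * I / 2)) ^ (3 + 1) = (π / 2 : ℂ) ^ 4 * I ^ 4 by ring,
      show (-(π * I / 2)) ^ (4 + 1) = -(π / 2 : ℂ) ^ 5 * (I ^ 4 * I) by ring,
      show (-(π * I / 2)) ^ (5 + 1) = (π / 2 : ℂ) ^ 6 * (I ^ 4 * I ^ 2) by ring, I_pow_four, I_sq,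
      show (Nat.factorial 3 : ℂ) = 6 by norm_num [Nat.factorial],
      show (Nat.factorial 4 : ℂ) = 24 by norm_num [Nat.factorial],
      show (Nat.factorial 5 : ℂ) = 120 by norm_num [Nat.factorial]]
    linear_combination (-(I * b * (π / 2 : ℂ) ^ 5 / 6 * charSeries 4 b)) * I_sq

lemma integral_pow_five_mul_sechCube_re (l : ℕ) :
    (∫ x : ℝ in Set.Ioi 0, x ^ 5 * sechCube (cexp (-((1 - I) / 2 * x))) *
      cexp (-((2 * l + 1) * ((1 + I) / 2) * x))).re =
    -480 * ((π / 2) ^ 4 / 3 * charSeries 3 (2 * l + 1) -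
      (2 * l + 1) * (π / 2) ^ 5 / 6 * charSeries 4 (2 * l + 1) +
      ((2 * l + 1) ^ 2 + 1) * (π / 2) ^ 6 / 60 * charSeries 5 (2 * l + 1)) := by
  set J := ∫ x : ℝ in Set.Ioi 0, x ^ 5 * sechCube (cexp (-((1 - I) / 2 * x))) *
      cexp (-((2 * l + 1) * ((1 + I) / 2) * x)) with hJ
  have hJ' : J = ∫ x : ℝ in Set.Ioi 0, x ^ 5 * cexp (-((2 * l + 1) * ((1 + I) / 2) * x)) *
      sechCube (cexp (-((1 - I) / 2 * x))) := by
    rw [hJ]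
    congr 1
    funext x
    ring
  have h1 := hasSum_integral_sechCube (w := (1 - I) / 2)
    (g := fun x : ℝ => cexp (-((2 * l + 1) * ((1 + I) / 2) * x))) (by simp) (by fun_prop)
    (fun x hx => by
      rw [norm_exp, Real.exp_le_one_iff,
        show (2 * l + 1 : ℂ) = ((2 * l + 1 : ℝ) : ℂ) by push_cast; ring, neg_re, re_mul_ofReal,
        re_ofReal_mul]
      simp
      positivity)
  rw [← hJ'] at h1
  have h2 (m : ℕ) : ∫ x : ℝ in Set.Ioi 0, x ^ 5 * cexp (-((2 * l + 1) * ((1 + I) / 2) * x)) *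
      cexp (-((2 * m + 1) * ((1 - I) / 2) * x)) =
      -960 * I / (2 * m + 1 + I * (2 * l + 1 : ℝ)) ^ 6 := by
    have h := integral_pow_mul_cexp_neg_mul 5
      (w := (2 * l + 1) * ((1 + I) / 2) + (2 * m + 1) * ((1 - I) / 2)) (by
        simp
        positivity)
    have he (x : ℝ) : (x : ℂ) ^ 5 * cexp (-((2 * l + 1) * ((1 + I) / 2) * x)) *
        cexp (-((2 * m + 1) * ((1 - I) / 2) * x)) = x ^ 5 *
        cexp (-(((2 * l + 1) * ((1 + I) / 2) + (2 * m + 1) * ((1 - I) / 2)) * x)) := by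
      rw [mul_assoc, ← Complex.exp_add]
      congr 2
      ring
    simp_rw [he]
    have hI : ((1 - I) / 2) ^ 6 = I / 8 := by
      rw [show ((1 - I) / 2) ^ 6 = (1 - 2 * I + I ^ 2) ^ 3 / 64 by ring, I_sq,
        show (1 - 2 * I + -1) ^ 3 / 64 = -(I ^ 2 * I) / 8 by ring, I_sq]
      ring
    rw [h, show (2 * l + 1) * ((1 + I) / 2) + (2 * m + 1) * ((1 - I) / 2) =
      (1 - I) / 2 * (2 * m + 1 + I * (2 * l + 1 : ℝ)) by
        push_cast
        linear_combination ((2 * l + 1 : ℂ) / 2) * I_sq, mul_pow, hI,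
      show ((5 : ℕ).factorial : ℂ) = 120 by norm_num [Nat.factorial]]
    rw [← div_div]
    congr 1
    rw [div_eq_iff (by simp)]
    linear_combination 120 * I_sq
  simp_rw [h2] at h1
  have h3 := h1.add (hasSum_conj'.mpr h1)
  have h4 := ((hasSum_alternating_quadratic_div (b := 2 * l + 1)
    (by positivity)).nat_add_neg_add_one).mul_left (960 * I)
  have h5 := h3.unique (h4.congr_fun (fun m => ?_))
  · rw [add_conj] at h5
    have h6 : ((2 * J.re : ℝ) : ℂ) = (-960 * ((π / 2) ^ 4 / 3 * charSeries 3 (2 * l + 1) -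
        (2 * l + 1) * (π / 2) ^ 5 / 6 * charSeries 4 (2 * l + 1) +
        ((2 * l + 1) ^ 2 + 1) * (π / 2) ^ 6 / 60 * charSeries 5 (2 * l + 1)) : ℝ) := by
      rw [h5, ← mul_assoc, mul_assoc 960, I_mul_I]
      push_cast
      ring
    rw [ofReal_inj] at h6
    linarith
  · have a1 : (starRingEnd ℂ) (sechCubeCoeff m *
        (-960 * I / (2 * m + 1 + I * (2 * l + 1 : ℝ)) ^ 6)) =
        sechCubeCoeff m * (960 * I / (2 * m + 1 - I * (2 * l + 1 : ℝ)) ^ 6) := by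
      simp [conj_ofNat, sub_eq_add_neg]
    have a2 : (2 * ((-(m + 1) : ℤ) : ℂ) + 1 + I * (2 * l + 1 : ℝ)) ^ 6 =
        (2 * m + 1 - I * (2 * l + 1 : ℝ)) ^ 6 := by
      push_cast
      ring
    rw [a1, a2, neg_one_zpow_neg_add_one, zpow_natCast, sechCubeCoeff]
    push_cast
    ring

lemma hasSum_integral_cos_add_cosh :
    HasSum (fun l : ℕ => sechCubeCoeff l * (-480 * ((π / 2) ^ 4 / 3 * charSeries 3 (2 * l + 1) -
      (2 * l + 1) * (π / 2) ^ 5 / 6 * charSeries 4 (2 * l + 1) +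
      ((2 * l + 1) ^ 2 + 1) * (π / 2) ^ 6 / 60 * charSeries 5 (2 * l + 1))))
      (8 * ∫ x in Set.Ioi 0, x ^ 5 / (Real.cos x + Real.cosh x) ^ 3) := by
  have h := hasSum_integral_sechCube (w := (1 + I) / 2)
    (g := fun x : ℝ => sechCube (cexp (-((1 - I) / 2 * x)))) (by simp)
    (by unfold sechCube; fun_prop) (fun x _ => norm_sechCube_le x)
  have h1 : ∀ x : ℝ, (x : ℂ) ^ 5 * sechCube (cexp (-((1 - I) / 2 * x))) *
      sechCube (cexp (-((1 + I) / 2 * x))) =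
      (8 * (x ^ 5 / (Real.cos x + Real.cosh x) ^ 3) : ℝ) := fun x => by
    rw [mul_assoc, mul_comm (sechCube _), sechCube_mul_sechCube]
    push_cast
    ring
  simp_rw [h1] at h
  rw [integral_complex_ofReal, MeasureTheory.integral_const_mul] at h
  have h2 := hasSum_re h
  rw [ofReal_re] at h2
  refine h2.congr_fun (fun l => ?_)
  rw [re_ofReal_mul, integral_pow_five_mul_sechCube_re]

end ComplexIntegral

lemma integral_eq_lambert :
    ∫ x in Set.Ioi 0, x ^ 5 / (Real.cos x + Real.cosh x) ^ 3 =
      20 * (π / 2) ^ 4 *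
        (lambert 0 signOdd 3 2 1 0 (π / 2) - lambert 0 signOdd 3 0 1 0 (π / 2)) -
      10 * (π / 2) ^ 5 *
        (lambert 0 signOdd 4 3 1 0 (π / 2) - lambert 0 signOdd 4 1 1 0 (π / 2)) +
      (π / 2) ^ 6 * (lambert 0 signOdd 5 4 1 0 (π / 2) - lambert 0 signOdd 5 0 1 0 (π / 2)) := by
  have h (i k : ℕ) : HasSum (fun l : ℕ => (-1) ^ l * (2 * l + 1 : ℝ) ^ k * charSeries i (2 * l + 1))
      (lambert 0 signOdd i k 1 0 (π / 2)) := by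
    simpa using hasSum_lambert_charSeries i k one_pos
  have h1 := ((((h 3 2).sub (h 3 0)).mul_left (20 * (π / 2) ^ 4)).sub
    (((h 4 3).sub (h 4 1)).mul_left (10 * (π / 2) ^ 5))).add
    (((h 5 4).sub (h 5 0)).mul_left ((π / 2) ^ 6))
  have h2 := hasSum_integral_cos_add_cosh.unique ((h1.mul_left 8).congr_fun fun l => by
    rw [sechCubeCoeff]
    ring)
  linarith

theorem integral_x5_cos_plus_cosh_cubed :
    (∫ x in Set.Ioi (0:ℝ), x ^ 5 / (Real.cos x + Real.cosh x) ^ 3) =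
      15 * Real.Gamma (1/4) ^ 4 / (2 ^ 8 * π)
    + 5 * Real.Gamma (1/4) ^ 12 / (2 ^ 13 * π ^ 5)
    - 5 * Real.Gamma (1/4) ^ 12 / (2 ^ 13 * π ^ 4)
    + 3 * Real.Gamma (1/4) ^ 12 / (2 ^ 15 * π ^ 3)
    + Real.Gamma (1/4) ^ 20 / (2 ^ 20 * π ^ 9) := by
  have hβ : 0 < π / 2 := by positivity
  have hp : oddSeries 1 0 1 0 (π / 2) ≠ 0 := (oddSeries_one_pos (by simp)).ne'
  have hr := oddSeries_three_pi_div_two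
  have he := evenSeries_one_pi_div_two hp
  have h30 := hr
  have h41 := oddSeries_four_one_of_eq_zero hβ hp hr
  have h50 := oddSeries_five_apply_zero hβ
  obtain ⟨h32, h43⟩ := oddSeries_four_three_of_eq_zero hβ hp hr
  have h54 := oddSeries_five_four_of_eq_zero hβ hp hr
  rw [he] at h32 h43 h54
  have hG := Gamma_one_fourth_pow_four
  rw [hr] at h50
  set p := oddSeries 1 0 1 0 (π / 2)
  have h50' : oddSeries 5 0 5 0 (π / 2) = -12 * p ^ 3 := by
    apply mul_left_cancel₀ hp
    linear_combination h50
  simp only [oddSeries_add_two _ _ 1, oddSeries_add_two _ _ 3] at h30 h41 h50'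
  simp only [oddSeries] at h30 h41 h50' h32 h43 h54
  rw [integral_eq_lambert,
    show lambert 0 signOdd 3 0 1 0 (π / 2) = 0 by linarith,
    show lambert 0 signOdd 4 1 1 0 (π / 2) = -p ^ 3 by linarith,
    show lambert 0 signOdd 5 0 1 0 (π / 2) = -3 * p ^ 3 by linarith,
    show lambert 0 signOdd 3 2 1 0 (π / 2) = (-2 * p ^ 3 + 6 * (1 / π) ^ 2 * p) / 4 by linarith,
    show lambert 0 signOdd 4 3 1 0 (π / 2) =
      (24 * (1 / π) ^ 3 * p - 24 * (1 / π) * p ^ 3) / 4 by linarith,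
    show lambert 0 signOdd 5 4 1 0 (π / 2) =
      (8 * p ^ 5 - 240 * (1 / π) ^ 2 * p ^ 3 + 120 * (1 / π) ^ 4 * p) / 4 by linarith,
    show Gamma (1 / 4) ^ 12 = (Gamma (1 / 4) ^ 4) ^ 3 by ring,
    show Gamma (1 / 4) ^ 20 = (Gamma (1 / 4) ^ 4) ^ 5 by ring, hG]
  have := pi_ne_zero
  field_simp
  ring
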